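/- arXiv:1905.03067 — 2 statements merged into one kernel-verified Lean document; each statement's English description precedes it below -/
import Mathlib

section
/- For i = 1,2 let Γᵢ be a finite 2-edge-connected oriented simple graph with edge set Eᵢ and spanning tree Tᵢ, and let G_F(Γᵢ,Tᵢ) be its q-flow Gram matrix. Then the following are equivalent: (1) there exists an isomorphism of q-flow lattices, i.e. an R-module isomorphism φ : R^{E₁∖T₁} → R^{E₂∖T₂} which satisfies ⟨φ(x), φ(y)⟩₂ = ⟨x,y⟩₁ for all x, y (where ⟨x,y⟩ᵢ := ∑_{f,g} σ(x_f)·G_F(Γᵢ,Tᵢ)(f,g)·y_g) and which commutes with the entrywise application of σ (this expresses compatibility with the q-antilinear involutions d fixing the fundamental-cycle bases); (2) there exists a cycle-preserving bijection F : E₁ → E₂ with F(T₁) = T₂. -/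
open LaurentPolynomial

/-- The incidence matrix of an oriented simple graph: rows indexed by vertices, columns by
edges; entry `1` at the head of an edge, `-1` at the tail, `0` otherwise. -/
def incMat {V : Type} [DecidableEq V] (G : SimpleGraph V)
    (head tail : G.edgeSet → V) : Matrix V G.edgeSet ℤ :=
  fun v e => if v = head e then 1 else if v = tail e then -1 else 0

/-- `head` and `tail` form an orientation of `G`: every edge is the pair of its head and
its tail. -/
def IsOrientation {V : Type} (G : SimpleGraph V) (head tail : G.edgeSet → V) : Prop :=
  ∀ e : G.edgeSet, (e : Sym2 V) = s(head e, tail e)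

/-- `T` is a spanning tree of `G`: the spanning subgraph with edge set `T` is connected
and `|T| = |V| - 1`. -/
def IsSpanningTree {V : Type} [Fintype V] (G : SimpleGraph V) (T : Set G.edgeSet) : Prop :=
  (SimpleGraph.fromEdgeSet (Subtype.val '' T)).Connected ∧ T.ncard + 1 = Fintype.card V

/-- `G` is 2-edge-connected: connected, with at least two vertices, and deleting any
single edge leaves it connected. -/
def TwoEdgeConnected {V : Type} [Fintype V] (G : SimpleGraph V) : Prop :=
  G.Connected ∧ 1 < Fintype.card V ∧
    ∀ e ∈ G.edgeSet, (G.deleteEdges {e}).Connected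

/-- `S` is the edge set of a cycle of `G` (a closed walk of length ≥ 3 with no repeated
vertices other than its endpoints). -/
def IsCycleSet {V : Type} (G : SimpleGraph V) (S : Set G.edgeSet) : Prop :=
  ∃ (u : V) (w : G.Walk u u), w.IsCycle ∧ Subtype.val '' S = {s | s ∈ w.edges}

/-- The q-flow Gram matrix of `(Γ,T)` built from a family `C` of fundamental cycles:
diagonal entries `1 + (⟨C_f,C_f⟩ − 1)·q²`, off-diagonal entries `⟨C_f,C_g⟩·q²`. -/
noncomputable def qFlowGram {V : Type} [DecidableEq V] (G : SimpleGraph V)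
    [Fintype G.edgeSet] (T : Set G.edgeSet)
    (C : {e : G.edgeSet // e ∉ T} → G.edgeSet → ℤ) :
    Matrix {e : G.edgeSet // e ∉ T} {e : G.edgeSet // e ∉ T} (LaurentPolynomial ℤ) :=
  fun f g => if f = g then
    1 + (((∑ e, C f e * C f e) - 1 : ℤ) : LaurentPolynomial ℤ) * LaurentPolynomial.T 2
  else (((∑ e, C f e * C g e : ℤ)) : LaurentPolynomial ℤ) * LaurentPolynomial.T 2

section FlowAux

/-- weak form of the conservation law -/
def FFlow {V E : Type} [Fintype E] (h t : E → V) (x : E → ℤ) : Prop :=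
  ∀ p : V → ℤ, ∑ e, (p (h e) - p (t e)) * x e = 0

/-- weak form of: boundary of `x` is `b - a` -/
def FBd {V E : Type} [Fintype E] (h t : E → V) (x : E → ℤ) (a b : V) : Prop :=
  ∀ p : V → ℤ, ∑ e, (p (h e) - p (t e)) * x e = p b - p a

lemma FBd.flow {V E : Type} [Fintype E] {h t : E → V} {x : E → ℤ} {a : V}
    (hx : FBd h t x a a) : FFlow h t x := fun p => by rw [hx p]; ring

lemma FFlow.add {V E : Type} [Fintype E] {h t : E → V} {x y : E → ℤ}
    (hx : FFlow h t x) (hy : FFlow h t y) : FFlow h t (fun e => x e + y e) := by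
  intro p
  simp only [mul_add, Finset.sum_add_distrib, hx p, hy p, add_zero]

lemma FFlow.smul {V E : Type} [Fintype E] {h t : E → V} {x : E → ℤ} (c : ℤ)
    (hx : FFlow h t x) : FFlow h t (fun e => c * x e) := by
  intro p
  have := hx p
  calc _ = c * ∑ e, (p (h e) - p (t e)) * x e := by
        rw [Finset.mul_sum]; exact Finset.sum_congr rfl fun e _ => by ring
    _ = 0 := by rw [this, mul_zero]

lemma FFlow.sub {V E : Type} [Fintype E] {h t : E → V} {x y : E → ℤ}
    (hx : FFlow h t x) (hy : FFlow h t y) : FFlow h t (fun e => x e - y e) := by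
  intro p
  simp only [mul_sub, Finset.sum_sub_distrib, hx p, hy p, sub_zero]

lemma FFlow.sum {V E N : Type} [Fintype E] [Fintype N] {h t : E → V} {C : N → E → ℤ}
    (hC : ∀ f, FFlow h t (C f)) (c : N → ℤ) : FFlow h t (fun e => ∑ f, c f * C f e) := by
  intro p
  simp only [Finset.mul_sum]
  rw [Finset.sum_comm]
  refine Finset.sum_eq_zero fun f _ => ?_
  exact (hC f).smul (c f) p

/-- every nonzero flow contains a conformal nonzero `0, ±1` flow -/
lemma FFlow.conformal {V E : Type} [Fintype E] {h t : E → V} {x : E → ℤ}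
    (hx : FFlow h t x) (hne : x ≠ 0) :
    ∃ w : E → ℤ, FFlow h t w ∧ w ≠ 0 ∧ ∀ e, w e = 0 ∨ (x e ≠ 0 ∧ w e = Int.sign (x e)) := by
  classical
  let src : E → V := fun e => if 0 < x e then t e else h e
  let dst : E → V := fun e => if 0 < x e then h e else t e
  have key : ∀ (p : V → ℤ) e, (p (h e) - p (t e)) * Int.sign (x e)
      = if x e = 0 then 0 else p (dst e) - p (src e) := by
    intro p e
    rcases lt_trichotomy (x e) 0 with h0 | h0 | h0
    · simp [src, dst, h0.ne, not_lt.2 h0.le, Int.sign_eq_neg_one_of_neg h0]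
    · simp [h0]
    · simp [src, dst, h0.ne', h0, Int.sign_eq_one_of_pos h0]
  have key2 : ∀ (p : V → ℤ) e, (p (h e) - p (t e)) * x e
      = (if x e = 0 then 0 else p (dst e) - p (src e)) * |x e| := by
    intro p e
    rw [← key, mul_assoc, Int.sign_mul_abs]
  let S := {e : E // x e ≠ 0}
  have hnext : ∀ e : S, ∃ e' : S, src e'.1 = dst e.1 := by
    intro e
    by_contra hcon
    push Not at hcon
    have h0 := hx (fun v => if v = dst e.1 then 1 else 0)
    simp only [key2 (fun v => if v = dst e.1 then 1 else 0)] at h0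
    have hnn : ∀ e' ∈ Finset.univ, 0 ≤ (if x e' = 0 then 0 else
        (if dst e' = dst e.1 then (1:ℤ) else 0) - (if src e' = dst e.1 then 1 else 0)) * |x e'| := by
      intro e' _
      by_cases h1 : x e' = 0
      · simp [h1]
      · have := hcon ⟨e', h1⟩
        simp only [h1, this, if_false, sub_zero]
        split_ifs <;> simp
    rw [Finset.sum_eq_zero_iff_of_nonneg hnn] at h0
    have h1 := h0 e.1 (Finset.mem_univ _)
    have h2 := hcon e
    simp [e.2, h2] at h1
  choose next hn using hnext
  obtain ⟨e0, he0⟩ : ∃ e, x e ≠ 0 := by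
    by_contra hcon; push Not at hcon; exact hne (funext hcon)
  obtain ⟨m, n, hmn, hit⟩ := Finite.exists_ne_map_eq_of_infinite (fun n : ℕ => next^[n] ⟨e0, he0⟩)
  have hper : ∃ e, e ∈ Function.periodicPts next := by
    wlog hlt : m < n generalizing m n
    · exact this n m hmn.symm hit.symm (by omega)
    refine ⟨next^[m] ⟨e0, he0⟩, Function.mk_mem_periodicPts (n := n - m) (by omega) ?_⟩
    show next^[n - m] (next^[m] _) = _
    rw [← Function.iterate_add_apply]
    rw [Nat.sub_add_cancel hlt.le, hit]
  have hbij := Function.bijOn_periodicPts next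
  let P : Finset S := Finset.univ.filter (· ∈ Function.periodicPts next)
  let Q : Finset E := P.map ⟨Subtype.val, Subtype.val_injective⟩
  have hQ : ∀ e ∈ Q, x e ≠ 0 := by
    intro e he
    obtain ⟨e', _, rfl⟩ := Finset.mem_map.1 he
    exact e'.2
  refine ⟨fun e => if e ∈ Q then Int.sign (x e) else 0, ?_, ?_, ?_⟩
  · intro p
    have h1 : ∑ e, (p (h e) - p (t e)) * (if e ∈ Q then Int.sign (x e) else 0)
        = ∑ e ∈ Q, (p (dst e) - p (src e)) := by
      simp only [mul_ite, mul_zero, Finset.sum_ite_mem, Finset.univ_inter]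
      refine Finset.sum_congr rfl fun e he => ?_
      rw [key, if_neg (hQ e he)]
    rw [h1, Finset.sum_map, Finset.sum_sub_distrib, sub_eq_zero]
    simp only [Function.Embedding.coeFn_mk, ← hn]
    refine Finset.sum_bij (fun e _ => next e) ?_ ?_ ?_ ?_
    · intro e he
      simp only [P, Finset.mem_filter, Finset.mem_univ, true_and] at he ⊢
      exact hbij.mapsTo he
    · intro a ha b hb hab
      simp only [P, Finset.mem_filter, Finset.mem_univ, true_and] at ha hb
      exact hbij.injOn ha hb hab
    · intro b hb
      simp only [P, Finset.mem_filter, Finset.mem_univ, true_and] at hb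
      obtain ⟨a, ha, hab⟩ := hbij.surjOn hb
      exact ⟨a, by simpa [P] using ha, hab⟩
    · intro a _
      rfl
  · obtain ⟨e, he⟩ := hper
    intro h0
    have := congrFun h0 e.1
    have he' : e.1 ∈ Q := Finset.mem_map.2 ⟨e, by simpa [P] using he, rfl⟩
    simp only [if_pos he', Pi.zero_apply] at this
    exact e.2 (Int.sign_eq_zero_iff_zero.1 this)
  · intro e
    by_cases h1 : e ∈ Q
    · right; exact ⟨hQ e h1, by simp [h1]⟩
    · left; simp [h1]

end FlowAux
section MetricAux

/-- integer combination of a family of vectors -/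
def comb {N E : Type} [Fintype N] (C : N → E → ℤ) (x : N → ℤ) : E → ℤ :=
  fun e => ∑ f, x f * C f e

lemma comb_sub {N E : Type} [Fintype N] (C : N → E → ℤ) (x y : N → ℤ) (e : E) :
    comb C (fun f => x f - y f) e = comb C x e - comb C y e := by
  simp [comb, sub_mul, Finset.sum_sub_distrib]

lemma comb_sq {N E : Type} [Fintype N] [Fintype E] (C : N → E → ℤ) (x : N → ℤ) :
    ∑ e, comb C x e ^ 2 = ∑ f, ∑ g, x f * x g * ∑ e, C f e * C g e := by
  simp only [comb, sq, Finset.sum_mul_sum]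
  simp only [Finset.mul_sum]
  rw [Finset.sum_comm]
  refine Finset.sum_congr rfl fun f _ => ?_
  rw [Finset.sum_comm]
  exact Finset.sum_congr rfl fun g _ => Finset.sum_congr rfl fun e _ => by ring

/-- conformal property of a family -/
def ConfFam {N E : Type} [Fintype N] (C : N → E → ℤ) : Prop :=
  ∀ x, comb C x ≠ 0 → ∃ w, comb C w ≠ 0 ∧
    ∀ e, comb C w e = 0 ∨ (comb C x e ≠ 0 ∧ comb C w e = Int.sign (comb C x e))

lemma abs_le_sq_int (a : ℤ) : |a| ≤ a ^ 2 := by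
  rw [← sq_abs]
  rcases eq_or_ne a 0 with h | h
  · simp [h]
  · have : 1 ≤ |a| := Int.one_le_abs h
    nlinarith

lemma l1_le {N E E' : Type} [Fintype N] [Fintype E] [Fintype E'] (C : N → E → ℤ)
    (C' : N → E' → ℤ)
    (hgram : ∀ f g, ∑ e, C f e * C g e = ∑ e, C' f e * C' g e) (hC : ConfFam C) (x : N → ℤ) :
    ∑ e, |comb C' x e| ≤ ∑ e, |comb C x e| := by
  have hsq : ∀ x, ∑ e, comb C' x e ^ 2 = ∑ e, comb C x e ^ 2 := by
    intro x; simp only [comb_sq, hgram]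
  obtain ⟨n, hn⟩ : ∃ n : ℕ, ∑ e, |comb C x e| ≤ n :=
    ⟨(∑ e, |comb C x e|).toNat, Int.self_le_toNat _⟩
  induction n generalizing x with
  | zero =>
    have h0 : ∀ e ∈ Finset.univ, |comb C x e| = 0 := by
      rw [← Finset.sum_eq_zero_iff_of_nonneg (fun _ _ => abs_nonneg _)]
      exact le_antisymm (by simpa using hn) (Finset.sum_nonneg fun _ _ => abs_nonneg _)
    have h1 := hsq x
    calc _ ≤ ∑ e, comb C' x e ^ 2 := Finset.sum_le_sum fun e _ => abs_le_sq_int _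
      _ = ∑ e, comb C x e ^ 2 := h1
      _ = 0 := Finset.sum_eq_zero fun e he => by simpa using h0 e he
      _ ≤ _ := Finset.sum_nonneg fun _ _ => abs_nonneg _
  | succ n ih =>
    by_cases hx : comb C x = 0
    · apply ih
      simp [hx]
    obtain ⟨w, hw0, hw⟩ := hC x hx
    have hsplit : ∀ e, |comb C (fun f => x f - w f) e| = |comb C x e| - comb C w e ^ 2 := by
      intro e
      rw [comb_sub]
      rcases hw e with h | ⟨h, h'⟩
      · simp [h]
      · rw [h']
        rcases lt_or_gt_of_ne h with h | h
        · rw [Int.sign_eq_neg_one_of_neg h, abs_of_neg h, abs_of_nonpos (by omega)]; ring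
        · rw [Int.sign_eq_one_of_pos h, abs_of_pos h, abs_of_nonneg (by omega)]; ring
    have hpos : 0 < ∑ e, comb C w e ^ 2 := by
      refine lt_of_le_of_ne (Finset.sum_nonneg fun _ _ => sq_nonneg _) fun h => hw0 ?_
      have := (Finset.sum_eq_zero_iff_of_nonneg (fun _ _ => sq_nonneg _)).1 h.symm
      funext e
      simpa using this e (Finset.mem_univ _)
    have hs : ∑ e, |comb C (fun f => x f - w f) e| = ∑ e, |comb C x e| - ∑ e, comb C w e ^ 2 := by
      rw [← Finset.sum_sub_distrib]
      exact Finset.sum_congr rfl fun e _ => hsplit e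
    have h1 := ih (fun f => x f - w f) (by push_cast at hn; omega)
    have h2 : ∑ e, |comb C' x e| ≤ ∑ e, |comb C' (fun f => x f - w f) e| + ∑ e, comb C' w e ^ 2 := by
      rw [← Finset.sum_add_distrib]
      refine Finset.sum_le_sum fun e _ => ?_
      have h3 := abs_le_sq_int (comb C' w e)
      rw [comb_sub]
      have := abs_add_le (comb C' x e - comb C' w e) (comb C' w e)
      rw [sub_add_cancel] at this
      linarith
    rw [hsq w] at h2
    linarith

/-- dot product -/
def dt {N : Type} [Fintype N] (a x : N → ℤ) : ℤ := ∑ f, a f * x f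

lemma dt_lin {N : Type} [Fintype N] (a x y : N → ℤ) (k l : ℤ) :
    dt a (fun f => k * x f + l * y f) = k * dt a x + l * dt a y := by
  simp only [dt, Finset.mul_sum, ← Finset.sum_add_distrib]
  exact Finset.sum_congr rfl fun f _ => by ring

lemma dt_neg_left {N : Type} [Fintype N] (a x : N → ℤ) : dt (-a) x = - dt a x := by
  simp [dt]

lemma exists_bound {N : Type} [Fintype N] (B : Finset (N → ℤ)) (y : N → ℤ) :
    ∃ K : ℤ, 0 < K ∧ ∀ b ∈ B, |dt b y| < K := by
  refine ⟨∑ b ∈ B, |dt b y| + 1, ?_, ?_⟩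
  · have := Finset.sum_nonneg (s := B) (f := fun b => |dt b y|) (fun _ _ => abs_nonneg _)
    omega
  · intro b hb
    have := Finset.single_le_sum (s := B) (f := fun b => |dt b y|) (fun _ _ => abs_nonneg _) hb
    omega

lemma generic_vec {N : Type} [Fintype N] (s : N → ℤ) (B : Finset (N → ℤ))
    (hB : ∀ b ∈ B, ∃ y, dt s y = 0 ∧ dt b y ≠ 0) :
    ∃ x, dt s x = 0 ∧ ∀ b ∈ B, dt b x ≠ 0 := by
  classical
  induction B using Finset.induction_on with
  | empty => exact ⟨fun _ => 0, by simp [dt], by simp⟩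
  | insert a B ha ih =>
    obtain ⟨x, hx, hxB⟩ := ih fun b hb => hB b (Finset.mem_insert_of_mem hb)
    by_cases hax : dt a x = 0
    · obtain ⟨y, hy, hay⟩ := hB a (Finset.mem_insert_self _ _)
      obtain ⟨K, hK, hKB⟩ := exists_bound B y
      refine ⟨fun f => K * x f + 1 * y f, by rw [dt_lin, hx, hy]; ring, ?_⟩
      intro b hb
      rw [dt_lin]
      rcases Finset.mem_insert.1 hb with rfl | hb
      · rw [hax]; simpa using hay
      · intro h0
        have h1 := hKB b hb
        have h2 : dt b y = - (K * dt b x) := by linarith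
        rw [h2, abs_neg, abs_mul, abs_of_pos hK] at h1
        have := Int.one_le_abs (hxB b hb)
        nlinarith
    · refine ⟨x, hx, fun b hb => ?_⟩
      rcases Finset.mem_insert.1 hb with rfl | hb
      · exact hax
      · exact hxB b hb

/-- entries in `0, ±1` -/
def Tri {N : Type} (a : N → ℤ) : Prop := ∀ f, a f = 0 ∨ a f = 1 ∨ a f = -1

lemma sep_vec {N : Type} [Fintype N] (s a : N → ℤ) (hs : Tri s) (hs0 : s ≠ 0)
    (ha : Tri a) (ha0 : a ≠ 0) (h1 : a ≠ s) (h2 : a ≠ -s) : ∃ y, dt s y = 0 ∧ dt a y ≠ 0 := by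
  classical
  by_contra hcon
  push Not at hcon
  obtain ⟨i, hi⟩ : ∃ i, s i ≠ 0 := by
    by_contra h; push Not at h; exact hs0 (funext h)
  -- test vectors `s i e_j - s j e_i`
  have hd : ∀ (b : N → ℤ) (j : N), dt b (fun f => s i * (Pi.single j 1 : N → ℤ) f
      + (- s j) * (Pi.single i 1 : N → ℤ) f) = s i * b j - s j * b i := by
    intro b j
    rw [dt_lin]
    simp [dt, Pi.single_apply]
    ring
  have hz : ∀ j, s i * a j = s j * a i := by
    intro j
    have := hcon _ ((hd s j).trans (by ring))
    rw [hd] at this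
    linarith
  have hii : s i * s i = 1 := by rcases hs i with h | h | h <;> simp_all
  have haj : ∀ j, a j = (s i * a i) * s j := by
    intro j
    calc a j = (s i * s i) * a j := by rw [hii, one_mul]
      _ = s i * (s i * a j) := by ring
      _ = _ := by rw [hz]; ring
  have hai : s i * a i = 0 ∨ s i * a i = 1 ∨ s i * a i = -1 := by
    rcases hs i with h | h | h <;> rcases ha i with h' | h' | h' <;> simp [h, h']
  rcases hai with h | h | h
  · exact ha0 (funext fun j => by rw [haj, h]; simp)
  · exact h1 (funext fun j => by rw [haj, h]; simp)
  · exact h2 (funext fun j => by rw [haj, h]; simp)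

open Classical in
lemma kink {N E : Type} [Fintype N] [Fintype E] (a : E → N → ℤ) (s x : N → ℤ) (K : ℤ)
    (hsx : dt s x = 0) (hx : ∀ e, a e ≠ s → a e ≠ -s → dt (a e) x ≠ 0)
    (hK : ∀ e, |dt (a e) s| < K) :
    ∑ e, |dt (a e) (fun f => K * x f + 1 * s f)| + ∑ e, |dt (a e) (fun f => K * x f + (-1) * s f)|
      - 2 * ∑ e, |dt (a e) (fun f => K * x f + 0 * s f)|
    = 2 * dt s s * (Finset.univ.filter fun e => a e = s ∨ a e = -s).card := by
  have hss : 0 ≤ dt s s := Finset.sum_nonneg fun f _ => mul_self_nonneg _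
  rw [Finset.mul_sum, ← Finset.sum_add_distrib, ← Finset.sum_sub_distrib, Finset.card_filter,
    Nat.cast_sum, Finset.mul_sum]
  refine Finset.sum_congr rfl fun e _ => ?_
  simp only [dt_lin]
  by_cases h : a e = s ∨ a e = -s
  · rw [if_pos h]
    rcases h with h | h
    · rw [h, hsx]; simp [abs_of_nonneg hss]; ring
    · rw [h, dt_neg_left, dt_neg_left, hsx]; simp [abs_of_nonneg hss]; ring
  · rw [if_neg h]
    push Not at h
    have h1 := hx e h.1 h.2
    have h2 := abs_lt.1 (hK e)
    generalize dt (a e) x = u at *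
    generalize dt (a e) s = v at *
    rcases lt_or_gt_of_ne h1 with h3 | h3
    · have : K * u ≤ -K := by nlinarith
      rw [abs_of_nonpos (by linarith), abs_of_nonpos (by linarith), abs_of_nonpos (by linarith)]
      push_cast; ring
    · have : K ≤ K * u := by nlinarith
      rw [abs_of_nonneg (by linarith), abs_of_nonneg (by linarith), abs_of_nonneg (by linarith)]
      push_cast; ring

open Classical in
lemma count_eq {N E E' : Type} [Fintype N] [Fintype E] [Fintype E'] (a : E → N → ℤ)
    (a' : E' → N → ℤ) (ha : ∀ e, Tri (a e)) (ha' : ∀ e, Tri (a' e))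
    (ha0 : ∀ e, a e ≠ 0) (ha0' : ∀ e, a' e ≠ 0)
    (heq : ∀ x, ∑ e, |dt (a e) x| = ∑ e, |dt (a' e) x|) (s : N → ℤ) (hs : Tri s) (hs0 : s ≠ 0) :
    (Finset.univ.filter fun e => a e = s ∨ a e = -s).card
      = (Finset.univ.filter fun e => a' e = s ∨ a' e = -s).card := by
  let B0 : Finset (N → ℤ) := Finset.univ.image a ∪ Finset.univ.image a'
  have hmem : ∀ e, a e ∈ B0 := fun e => by simp [B0]
  have hmem' : ∀ e, a' e ∈ B0 := fun e => by simp [B0]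
  have hB0 : ∀ b ∈ B0, Tri b ∧ b ≠ 0 := by
    intro b hb
    simp only [B0, Finset.mem_union, Finset.mem_image, Finset.mem_univ, true_and] at hb
    rcases hb with ⟨e, rfl⟩ | ⟨e, rfl⟩
    · exact ⟨ha e, ha0 e⟩
    · exact ⟨ha' e, ha0' e⟩
  obtain ⟨x, hx, hxB⟩ := generic_vec s (B0.filter fun b => b ≠ s ∧ b ≠ -s) (by
    intro b hb
    obtain ⟨hb, h1, h2⟩ := Finset.mem_filter.1 hb
    exact sep_vec s b hs hs0 (hB0 b hb).1 (hB0 b hb).2 h1 h2)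
  obtain ⟨K, hK, hKB⟩ := exists_bound B0 s
  have k1 := kink a s x K hx (fun e h1 h2 => hxB _ (Finset.mem_filter.2 ⟨hmem e, h1, h2⟩))
    (fun e => hKB _ (hmem e))
  have k2 := kink a' s x K hx (fun e h1 h2 => hxB _ (Finset.mem_filter.2 ⟨hmem' e, h1, h2⟩))
    (fun e => hKB _ (hmem' e))
  rw [heq, heq, heq, k2] at k1
  have hss : 0 < dt s s := by
    refine lt_of_le_of_ne (Finset.sum_nonneg fun f _ => mul_self_nonneg _) fun h => hs0 ?_
    have := (Finset.sum_eq_zero_iff_of_nonneg (fun f _ => mul_self_nonneg (s f))).1 h.symm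
    funext f
    simpa using this f (Finset.mem_univ _)
  have := mul_left_cancel₀ (by positivity) k1
  exact_mod_cast this.symm

lemma exists_row_equiv {N E E' : Type} [Fintype N] [Fintype E] [Fintype E'] (a : E → N → ℤ)
    (a' : E' → N → ℤ) (ha : ∀ e, Tri (a e)) (ha' : ∀ e, Tri (a' e))
    (ha0 : ∀ e, a e ≠ 0) (ha0' : ∀ e, a' e ≠ 0)
    (heq : ∀ x, ∑ e, |dt (a e) x| = ∑ e, |dt (a' e) x|) :
    ∃ F : E ≃ E', ∀ e, a' (F e) = a e ∨ a' (F e) = - a e := by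
  classical
  let c : E → Set (N → ℤ) := fun e => {a e, - a e}
  let c' : E' → Set (N → ℤ) := fun e => {a' e, - a' e}
  have hpair : ∀ u v : N → ℤ, ({u, -u} : Set (N → ℤ)) = {v, -v} ↔ (u = v ∨ u = -v) := by
    intro u v
    constructor
    · intro h
      have : u ∈ ({v, -v} : Set (N → ℤ)) := h ▸ Set.mem_insert _ _
      simpa using this
    · rintro (h | h)
      · rw [h]
      · rw [h, neg_neg, Set.pair_comm]
  have hcard : ∀ S : Set (N → ℤ), Nonempty ({e // c e = S} ≃ {e // c' e = S}) := by
    intro S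
    by_cases hS : ∃ s, Tri s ∧ s ≠ 0 ∧ S = {s, -s}
    · obtain ⟨s, hs, hs0, rfl⟩ := hS
      have := count_eq a a' ha ha' ha0 ha0' heq s hs hs0
      refine Fintype.card_eq.1 ?_
      rw [Fintype.card_subtype, Fintype.card_subtype]
      simp only [c, c', hpair]
      exact this
    · have h1 : IsEmpty {e // c e = S} := ⟨fun e => hS ⟨a e.1, ha _, ha0 _, e.2.symm⟩⟩
      have h2 : IsEmpty {e // c' e = S} := ⟨fun e => hS ⟨a' e.1, ha' _, ha0' _, e.2.symm⟩⟩
      exact ⟨Equiv.equivOfIsEmpty _ _⟩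
  have eq : ∀ S, {e // c e = S} ≃ {e // c' e = S} := fun S => Classical.choice (hcard S)
  let F : E ≃ E' := (Equiv.sigmaFiberEquiv c).symm.trans
    ((Equiv.sigmaCongrRight eq).trans (Equiv.sigmaFiberEquiv c'))
  refine ⟨F, fun e => ?_⟩
  have : c' (F e) = c e := (eq (c e) ⟨e, rfl⟩).2
  exact (hpair _ _).1 this

end MetricAux
section SysAux

/-- A flow system: graph with a spanning tree and its fundamental cycles. -/
structure FSys {V E : Type} [Fintype E] (h t : E → V) (T : Set E)
    (C : {e : E // e ∉ T} → E → ℤ) : Prop where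
  zero : ∀ x, FFlow h t x → (∀ e, e ∉ T → x e = 0) → x = 0
  flow : ∀ f, FFlow h t (C f)
  one : ∀ f, C f f.1 = 1
  supp : ∀ f e, e ∉ T → e ≠ f.1 → C f e = 0

namespace FSys

variable {V E : Type} [Fintype E] {h t : E → V} {T : Set E} {C : {e : E // e ∉ T} → E → ℤ}

lemma single (S : FSys h t T C) (f : {e : E // e ∉ T}) {x : E → ℤ} (hx : FFlow h t x)
    (hs : ∀ e, e ∉ T → e ≠ f.1 → x e = 0) (e : E) : x e = x f.1 * C f e := by
  have := S.zero _ (hx.sub ((S.flow f).smul (x f.1))) (by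
    intro e he
    by_cases hef : e = f.1
    · subst hef; simp [S.one f]
    · simp [hs e he hef, S.supp f e he hef])
  have := congrFun this e
  simp only [Pi.zero_apply] at this
  linarith

lemma comb_nontree (S : FSys h t T C) [Fintype {e : E // e ∉ T}] (c : {e : E // e ∉ T} → ℤ)
    (f : {e : E // e ∉ T}) : comb C c f.1 = c f := by
  unfold comb
  rw [Fintype.sum_eq_single f]
  · rw [S.one, mul_one]
  · intro g hg
    rw [S.supp g f.1 f.2 (fun h => hg (Subtype.ext h.symm)), mul_zero]

lemma expand (S : FSys h t T C) [Fintype {e : E // e ∉ T}] {x : E → ℤ} (hx : FFlow h t x) :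
    comb C (fun f => x f.1) = x := by
  have h1 : FFlow h t (comb C (fun f => x f.1)) := FFlow.sum S.flow _
  have := S.zero _ (h1.sub hx) (by
    intro e he
    rw [S.comb_nontree _ ⟨e, he⟩, sub_self])
  funext e
  have := congrFun this e
  simp only [Pi.zero_apply] at this
  linarith

lemma tri (S : FSys h t T C) (f : {e : E // e ∉ T}) : Tri (C f) := by
  have hne : C f ≠ 0 := fun h0 => by
    have := S.one f; rw [h0] at this; simp at this
  obtain ⟨w, hw, hw0, hwe⟩ := (S.flow f).conformal hne
  have hs := S.single f hw (by
    intro e he hef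
    rcases hwe e with h | ⟨h, _⟩
    · exact h
    · exact absurd (S.supp f e he hef) h)
  have hwf : w f.1 = 1 := by
    rcases hwe f.1 with h | ⟨_, h⟩
    · exact absurd (funext fun e => by rw [hs, h]; simp) hw0
    · rw [h, S.one]; rfl
  intro e
  have h1 := hs e
  rw [hwf, one_mul] at h1
  rw [← h1]
  rcases hwe e with h | ⟨_, h⟩
  · left; exact h
  · rw [h]
    rcases Int.sign_trichotomy (C f e) with h | h | h <;> simp [h]

lemma conf (S : FSys h t T C) [Fintype {e : E // e ∉ T}] : ConfFam C := by
  intro x hx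
  obtain ⟨w, hw, hw0, hwe⟩ := (FFlow.sum S.flow x : FFlow h t (comb C x)).conformal hx
  refine ⟨fun f => w f.1, ?_, ?_⟩
  · rwa [S.expand hw]
  · rw [S.expand hw]; exact hwe

end FSys

lemma exists_potential {V E : Type} [Fintype E] {h t : E → V} {T : Set E} (r : V)
    (hconn : ∀ u, ∃ g : E → ℤ, FBd h t g r u ∧ ∀ e, e ∉ T → g e = 0)
    (τ : E → ZMod 2)
    (hτ : ∀ x : E → ℤ, FFlow h t x → (∀ e, e ∉ T → x e = 0) → ∑ e, (x e : ZMod 2) * τ e = 0) :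
    ∃ p : V → ZMod 2, ∀ e ∈ T, p (h e) - p (t e) = τ e := by
  classical
  choose g hg hgT using hconn
  refine ⟨fun u => ∑ e, (g u e : ZMod 2) * τ e, fun e he => ?_⟩
  have hx : FFlow h t (fun e' => g (h e) e' - g (t e) e' - (if e' = e then 1 else 0)) := by
    intro p
    simp only [mul_sub, Finset.sum_sub_distrib, hg _ p]
    simp
  have := hτ _ hx (by
    intro e' he'
    have : e' ≠ e := fun h => he' (h ▸ he)
    simp [hgT _ e' he', this])
  push_cast at this
  simp only [sub_mul, Finset.sum_sub_distrib, ite_mul, one_mul, zero_mul, Finset.sum_ite_eq',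
    Finset.mem_univ, if_true] at this
  simpa using sub_eq_zero.1 this

/-- integer lift of an element of `ZMod 2` -/
def lift2 (a : ZMod 2) : ℤ := if a = 0 then 0 else 1

/-- sign of an element of `ZMod 2` -/
def sgn2 (a : ZMod 2) : ℤ := if a = 0 then 1 else -1

lemma lift2_sub (a b : ZMod 2) : (a - b = 0 → lift2 a - lift2 b = 0) ∧
    (a - b = 1 → (lift2 a - lift2 b = 1 ∨ lift2 a - lift2 b = -1)) := by
  revert a b; decide

lemma sgn2_cases (a : ZMod 2) : sgn2 a = 1 ∨ sgn2 a = -1 := by revert a; decide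

lemma sgn2_sub (a b : ZMod 2) : (a - b = 0 → sgn2 a = sgn2 b) ∧
    (a - b = 1 → sgn2 a = - sgn2 b) := by revert a b; decide

lemma tri_cast {a b : ℤ} (ha : a = 0 ∨ a = 1 ∨ a = -1) (hb : b = 0 ∨ b = 1 ∨ b = -1)
    (h : a ≠ 0 ↔ b ≠ 0) : (a : ZMod 2) = (b : ZMod 2) := by
  rcases ha with rfl | rfl | rfl <;> rcases hb with rfl | rfl | rfl <;> simp at h ⊢

lemma exists_signs {V₁ V₂ E₁ E₂ : Type} [Fintype E₁] [Fintype E₂] [Fintype V₂]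
    {h₁ t₁ : E₁ → V₁} {h₂ t₂ : E₂ → V₂} {T₁ : Set E₁} {T₂ : Set E₂}
    {C₁ : {e : E₁ // e ∉ T₁} → E₁ → ℤ} {C₂ : {e : E₂ // e ∉ T₂} → E₂ → ℤ}
    (S₁ : FSys h₁ t₁ T₁ C₁) (S₂ : FSys h₂ t₂ T₂ C₂) (r₁ : V₁) (r₂ : V₂)
    (hc₁ : ∀ u, ∃ g : E₁ → ℤ, FBd h₁ t₁ g r₁ u)
    (hc₂ : ∀ u, ∃ g : E₂ → ℤ, FBd h₂ t₂ g r₂ u ∧ ∀ e, e ∉ T₂ → g e = 0)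
    (hne : ∀ e, h₂ e ≠ t₂ e) (F : E₁ ≃ E₂) (hF : ∀ e, e ∉ T₁ ↔ F e ∉ T₂)
    (hsupp : ∀ f e, C₁ f e ≠ 0 ↔ C₂ ⟨F f.1, (hF f.1).1 f.2⟩ (F e) ≠ 0) :
    ∃ η : E₁ → ℤ, (∀ e, η e = 1 ∨ η e = -1) ∧
      ∀ f e, C₂ ⟨F f.1, (hF f.1).1 f.2⟩ (F e) = η f.1 * η e * C₁ f e := by
  classical
  have step1 : ∀ v : V₂, ∃ p : V₁ → ZMod 2, ∀ e ∈ (Set.univ : Set E₁), p (h₁ e) - p (t₁ e) =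
      if v = h₂ (F e) ∨ v = t₂ (F e) then 1 else 0 := by
    intro v
    refine exists_potential r₁ (fun u => (hc₁ u).imp fun g hg => ⟨hg, fun e he => absurd trivial he⟩) _ ?_
    intro x hx _
    have hf : ∀ f, ∑ e, (C₁ f e : ZMod 2) * (if v = h₂ (F e) ∨ v = t₂ (F e) then 1 else 0) = 0 := by
      intro f
      have h1 : ∀ e, (C₁ f e : ZMod 2) = (C₂ ⟨F f.1, (hF f.1).1 f.2⟩ (F e) : ZMod 2) := fun e =>
        tri_cast (S₁.tri f e) (S₂.tri _ _) (hsupp f e)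
      simp only [h1]
      rw [Equiv.sum_comp F (fun e => ((C₂ ⟨F f.1, (hF f.1).1 f.2⟩ e : ℤ) : ZMod 2) *
        (if v = h₂ e ∨ v = t₂ e then 1 else 0))]
      have h2 := S₂.flow ⟨F f.1, (hF f.1).1 f.2⟩ (fun u => if v = u then 1 else 0)
      have h3 := congrArg (Int.cast : ℤ → ZMod 2) h2
      push_cast at h3
      refine Eq.trans ?_ h3
      refine Finset.sum_congr rfl fun e _ => ?_
      rw [mul_comm]
      congr 1
      have := hne e
      by_cases ha : v = h₂ e
      · have hb : v ≠ t₂ e := fun h => this (ha.symm.trans h)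
        simp [ha, this]
      · by_cases hb : v = t₂ e
        · simp [hb, this.symm]
        · simp [ha, hb]
    rw [← S₁.expand hx]
    simp only [comb]
    push_cast
    simp only [Finset.sum_mul]
    rw [Finset.sum_comm]
    refine Finset.sum_eq_zero fun f _ => ?_
    simp only [mul_assoc]
    rw [← Finset.mul_sum, hf, mul_zero]
  choose p hp using step1
  let d : V₂ → E₁ → ℤ := fun v e => lift2 (p v (h₁ e)) - lift2 (p v (t₁ e))
  have hd0 : ∀ v e, v ≠ h₂ (F e) → v ≠ t₂ (F e) → d v e = 0 := fun v e h1 h2 =>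
    (lift2_sub _ _).1 (by rw [hp v e trivial]; simp [h1, h2])
  have hdh : ∀ e, d (h₂ (F e)) e = 1 ∨ d (h₂ (F e)) e = -1 := fun e =>
    (lift2_sub _ _).2 (by rw [hp _ e trivial]; simp)
  have hdt : ∀ e, d (t₂ (F e)) e = 1 ∨ d (t₂ (F e)) e = -1 := fun e =>
    (lift2_sub _ _).2 (by rw [hp _ e trivial]; simp)
  obtain ⟨k, hk⟩ := exists_potential (h := h₂) (t := t₂) (T := T₂) r₂ hc₂
    (fun e => if d (h₂ e) (F.symm e) = - d (t₂ e) (F.symm e) then 0 else 1) (by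
      intro x hx hxT
      have := S₂.zero x hx hxT
      simp [this])
  let κ : V₂ → ℤ := fun v => sgn2 (k v)
  have hκ : ∀ v, κ v = 1 ∨ κ v = -1 := fun v => sgn2_cases _
  have hsum : ∀ (q : V₂ → ℤ) e, ∑ v, q v * κ v * d v e
      = q (h₂ (F e)) * κ (h₂ (F e)) * d (h₂ (F e)) e
        + q (t₂ (F e)) * κ (t₂ (F e)) * d (t₂ (F e)) e := by
    intro q e
    exact Fintype.sum_eq_add _ _ (hne _) fun v hv => by rw [hd0 v e hv.1 hv.2, mul_zero]
  have horth : ∀ (q : V₂ → ℤ) x, FFlow h₁ t₁ x → ∑ e, (∑ v, q v * κ v * d v e) * x e = 0 := by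
    intro q x hx
    rw [← hx (fun u => ∑ v, q v * κ v * lift2 (p v u))]
    refine Finset.sum_congr rfl fun e _ => ?_
    rw [← Finset.sum_sub_distrib]
    congr 1
    exact Finset.sum_congr rfl fun v _ => by simp only [d]; ring
  have hz : ∀ e, κ (h₂ (F e)) * d (h₂ (F e)) e + κ (t₂ (F e)) * d (t₂ (F e)) e = 0 := by
    have hzT : ∀ e, e ∈ T₁ →
        κ (h₂ (F e)) * d (h₂ (F e)) e + κ (t₂ (F e)) * d (t₂ (F e)) e = 0 := by
      intro e he
      have heT : F e ∈ T₂ := by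
        by_contra hcon; exact (hF e).2 hcon he
      have h1 := hk (F e) heT
      simp only [Equiv.symm_apply_apply] at h1
      by_cases h2 : d (h₂ (F e)) e = - d (t₂ (F e)) e
      · rw [if_pos h2] at h1
        have h3 : κ (h₂ (F e)) = κ (t₂ (F e)) := (sgn2_sub _ _).1 h1
        rw [h2, h3]; ring
      · rw [if_neg h2] at h1
        have h3 : κ (h₂ (F e)) = - κ (t₂ (F e)) := (sgn2_sub _ _).2 h1
        have h4 : d (h₂ (F e)) e = d (t₂ (F e)) e := by
          rcases hdh e with ha | ha <;> rcases hdt e with hb | hb <;> omega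
        rw [h4, h3]; ring
    intro e
    by_cases he : e ∈ T₁
    · exact hzT e he
    have h1 := horth (fun _ => 1) _ (S₁.flow ⟨e, he⟩)
    simp only [hsum] at h1
    simp only [one_mul] at h1
    rw [Fintype.sum_eq_single e, S₁.one ⟨e, he⟩, mul_one] at h1
    · exact h1
    · intro e' hee'
      by_cases he' : e' ∈ T₁
      · rw [hzT e' he', zero_mul]
      · rw [S₁.supp ⟨e, he⟩ e' he' hee', mul_zero]
  let η : E₁ → ℤ := fun e => κ (h₂ (F e)) * d (h₂ (F e)) e
  have hη : ∀ e, η e = 1 ∨ η e = -1 := by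
    intro e
    simp only [η]
    rcases hκ (h₂ (F e)) with ha | ha <;> rcases hdh e with hb | hb <;> simp [ha, hb]
  refine ⟨η, hη, fun f e => ?_⟩
  have hflow : FFlow h₂ t₂ (fun e' => η (F.symm e') * C₁ f (F.symm e')) := by
    intro q
    rw [← Equiv.sum_comp F]
    simp only [Equiv.symm_apply_apply]
    rw [← horth q _ (S₁.flow f)]
    refine Finset.sum_congr rfl fun e _ => ?_
    rw [hsum]
    have := hz e
    have h2 : κ (t₂ (F e)) * d (t₂ (F e)) e = - η e := by simp only [η]; linarith
    have h3 : κ (h₂ (F e)) * d (h₂ (F e)) e = η e := rfl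
    rw [mul_assoc (q _), mul_assoc (q _), h2, h3]
    ring
  have := S₂.single ⟨F f.1, (hF f.1).1 f.2⟩ hflow (by
    intro e he hef
    have h1 : F.symm e ∉ T₁ := by rw [hF]; simpa using he
    rw [S₁.supp f _ h1, mul_zero]
    intro h2
    exact hef ((Equiv.symm_apply_eq F).1 h2)) (F e)
  simp only [Equiv.symm_apply_apply, S₁.one, mul_one] at this
  rw [mul_assoc, this, ← mul_assoc]
  rcases hη f.1 with h | h <;> simp [h]

end SysAux
section RowAux

lemma l1_split {V E : Type} [Fintype E] {h t : E → V} {T : Set E}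
    {C : {e : E // e ∉ T} → E → ℤ} (S : FSys h t T C) [Fintype {e : E // e ∉ T}]
    [Fintype {e : E // e ∈ T}] (x : {e : E // e ∉ T} → ℤ) :
    ∑ e, |comb C x e| = ∑ e : {e : E // e ∈ T}, |comb C x e.1| + ∑ f, |x f| := by
  classical
  rw [← Fintype.sum_subtype_add_sum_subtype (fun e => e ∈ T) (fun e => |comb C x e|)]
  congr 1
  · exact Finset.sum_congr (by ext; simp) fun _ _ => rfl
  · refine Finset.sum_congr (by ext; simp) fun f _ => ?_
    rw [S.comb_nontree]

lemma exists_edge_equiv {V₁ V₂ E₁ E₂ : Type} [Fintype E₁] [Fintype E₂]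
    {h₁ t₁ : E₁ → V₁} {h₂ t₂ : E₂ → V₂} {T₁ : Set E₁} {T₂ : Set E₂}
    [Fintype {e : E₁ // e ∉ T₁}] [Fintype {e : E₂ // e ∉ T₂}]
    {C₁ : {e : E₁ // e ∉ T₁} → E₁ → ℤ} {C₂ : {e : E₂ // e ∉ T₂} → E₂ → ℤ}
    (S₁ : FSys h₁ t₁ T₁ C₁) (S₂ : FSys h₂ t₂ T₂ C₂)
    (hnz₁ : ∀ e, ∃ f, C₁ f e ≠ 0) (hnz₂ : ∀ e, ∃ f, C₂ f e ≠ 0)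
    (π : {e : E₁ // e ∉ T₁} ≃ {e : E₂ // e ∉ T₂}) (ε : {e : E₁ // e ∉ T₁} → ℤ)
    (hε : ∀ f, ε f = 1 ∨ ε f = -1)
    (hgram : ∀ f g, ∑ e, C₁ f e * C₁ g e = ε f * ε g * ∑ e, C₂ (π f) e * C₂ (π g) e) :
    ∃ (F : E₁ ≃ E₂) (η : E₁ → ℤ), (∀ e, η e = 1 ∨ η e = -1) ∧ (∀ e, e ∈ T₁ ↔ F e ∈ T₂) ∧
      ∀ f e, ε f * C₂ (π f) (F e) = η e * C₁ f e := by
  classical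
  let C' : {e : E₁ // e ∉ T₁} → E₂ → ℤ := fun f e => ε f * C₂ (π f) e
  have hεε : ∀ f, ε f * ε f = 1 := fun f => by rcases hε f with h | h <;> simp [h]
  have hcomb : ∀ x, comb C' x = comb C₂ (fun g => x (π.symm g) * ε (π.symm g)) := by
    intro x
    funext e
    simp only [comb, C']
    rw [← Equiv.sum_comp π]
    exact Finset.sum_congr rfl fun f _ => by simp [mul_assoc]
  have hcomb' : ∀ y, comb C₂ y = comb C' (fun f => y (π f) * ε f) := by
    intro y
    rw [hcomb]
    congr 1
    funext g
    simp [mul_assoc, hεε]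
  have hconf : ConfFam C' := by
    intro x hx
    rw [hcomb] at hx
    obtain ⟨w, hw0, hw⟩ := S₂.conf _ hx
    rw [hcomb']  at hw0
    refine ⟨_, hw0, ?_⟩
    rw [← hcomb', hcomb]
    exact hw
  have hg' : ∀ f g, ∑ e, C₁ f e * C₁ g e = ∑ e, C' f e * C' g e := by
    intro f g
    rw [hgram, Finset.mul_sum]
    exact Finset.sum_congr rfl fun e _ => by simp only [C']; ring
  have hl1 : ∀ x, ∑ e, |comb C₁ x e| = ∑ e, |comb C' x e| := fun x =>
    le_antisymm (l1_le C' C₁ (fun f g => (hg' f g).symm) hconf x) (l1_le C₁ C' hg' S₁.conf x)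
  let a : {e : E₁ // e ∈ T₁} → {e : E₁ // e ∉ T₁} → ℤ := fun e f => C₁ f e.1
  let a' : {e : E₂ // e ∈ T₂} → {e : E₁ // e ∉ T₁} → ℤ := fun e f => C' f e.1
  have hdt : ∀ e x, dt (a e) x = comb C₁ x e.1 := fun e x =>
    Finset.sum_congr rfl fun f _ => mul_comm _ _
  have hdt' : ∀ e x, dt (a' e) x = comb C' x e.1 := fun e x =>
    Finset.sum_congr rfl fun f _ => mul_comm _ _
  obtain ⟨F₀, hF₀⟩ := exists_row_equiv a a' (fun e f => S₁.tri f e.1)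
    (by
      intro e f
      simp only [a', C']
      rcases hε f with h | h <;> rcases S₂.tri (π f) e.1 with h' | h' | h' <;> simp [h, h'])
    (by
      intro e h0
      obtain ⟨f, hf⟩ := hnz₁ e.1
      exact hf (congrFun h0 f))
    (by
      intro e h0
      obtain ⟨g, hg⟩ := hnz₂ e.1
      have := congrFun h0 (π.symm g)
      simp only [a', C', Equiv.apply_symm_apply, Pi.zero_apply] at this
      rcases mul_eq_zero.1 this with h | h
      · rcases hε (π.symm g) with h' | h' <;> omega
      · exact hg h)
    (by
      intro x
      simp only [hdt, hdt']
      have h1 := hl1 x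
      rw [l1_split S₁] at h1
      rw [hcomb, l1_split S₂, ← hcomb] at h1
      have h2 : ∑ g, |x (π.symm g) * ε (π.symm g)| = ∑ f, |x f| := by
        rw [← Equiv.sum_comp π]
        refine Finset.sum_congr rfl fun f _ => ?_
        rw [Equiv.symm_apply_apply, abs_mul]
        rcases hε f with h | h <;> simp [h]
      rw [h2] at h1
      linarith)
  let F : E₁ ≃ E₂ := (Equiv.sumCompl (· ∈ T₁)).symm.trans
    ((Equiv.sumCongr F₀ π).trans (Equiv.sumCompl (· ∈ T₂)))
  have hFT : ∀ e : {e : E₁ // e ∈ T₁}, F e.1 = (F₀ e).1 := by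
    intro e
    simp [F, Equiv.sumCompl_symm_apply_of_pos e.2]
  have hFN : ∀ e : {e : E₁ // e ∉ T₁}, F e.1 = (π e).1 := by
    intro e
    simp [F, Equiv.sumCompl_symm_apply_of_neg e.2]
  have hη : ∀ e, ∃ η : ℤ, (η = 1 ∨ η = -1) ∧ ∀ f, ε f * C₂ (π f) (F e) = η * C₁ f e := by
    intro e
    by_cases he : e ∈ T₁
    · rw [hFT ⟨e, he⟩]
      rcases hF₀ ⟨e, he⟩ with h | h
      · exact ⟨1, Or.inl rfl, fun f => by rw [one_mul]; exact congrFun h f⟩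
      · exact ⟨-1, Or.inr rfl, fun f => by rw [neg_one_mul]; exact congrFun h f⟩
    · rw [hFN ⟨e, he⟩]
      refine ⟨ε ⟨e, he⟩, hε _, fun f => ?_⟩
      by_cases hf : f = ⟨e, he⟩
      · subst hf
        rw [S₂.one, S₁.one ⟨e, he⟩]
      · rw [S₂.supp _ _ (π ⟨e, he⟩).2, S₁.supp f e he]
        · simp
        · intro h; exact hf (Subtype.ext h.symm)
        · intro h; exact hf (π.injective (Subtype.ext h.symm))
  choose η hη1 hη2 using hη
  refine ⟨F, η, hη1, fun e => ?_, fun f e => hη2 e f⟩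
  by_cases he : e ∈ T₁
  · simp only [he, true_iff]
    rw [hFT ⟨e, he⟩]; exact (F₀ _).2
  · simp only [he, false_iff]
    rw [hFN ⟨e, he⟩]; exact (π _).2

/-- supports of flows are transported -/
lemma flow_transport {V₁ V₂ E₁ E₂ : Type} [Fintype E₁] [Fintype E₂]
    {h₁ t₁ : E₁ → V₁} {h₂ t₂ : E₂ → V₂} {T₁ : Set E₁} {T₂ : Set E₂}
    [Fintype {e : E₁ // e ∉ T₁}] [Fintype {e : E₂ // e ∉ T₂}]
    {C₁ : {e : E₁ // e ∉ T₁} → E₁ → ℤ} {C₂ : {e : E₂ // e ∉ T₂} → E₂ → ℤ}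
    (S₁ : FSys h₁ t₁ T₁ C₁) (S₂ : FSys h₂ t₂ T₂ C₂)
    (π : {e : E₁ // e ∉ T₁} ≃ {e : E₂ // e ∉ T₂}) (ε : {e : E₁ // e ∉ T₁} → ℤ)
    (hε : ∀ f, ε f = 1 ∨ ε f = -1) (F : E₁ ≃ E₂) (η : E₁ → ℤ) (hη : ∀ e, η e = 1 ∨ η e = -1)
    (hF : ∀ f e, ε f * C₂ (π f) (F e) = η e * C₁ f e) (x : E₁ → ℤ) :
    FFlow h₁ t₁ x ↔ FFlow h₂ t₂ (fun e => η (F.symm e) * x (F.symm e)) := by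
  have hεε : ∀ f, ε f * ε f = 1 := fun f => by rcases hε f with h | h <;> simp [h]
  have hηη : ∀ f, η f * η f = 1 := fun f => by rcases hη f with h | h <;> simp [h]
  constructor
  · intro hx
    have h1 : FFlow h₂ t₂ (comb C₂ (fun g => x (π.symm g).1 * ε (π.symm g))) := FFlow.sum S₂.flow _
    convert h1 using 1
    funext e
    obtain ⟨e, rfl⟩ := F.surjective e
    rw [Equiv.symm_apply_apply]
    conv_lhs => rw [← S₁.expand hx]
    simp only [comb, Finset.mul_sum]
    rw [← Equiv.sum_comp π]
    refine Finset.sum_congr rfl fun f _ => ?_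
    rw [Equiv.symm_apply_apply, mul_assoc, hF]
    ring
  · intro hx
    have h1 : FFlow h₁ t₁ (comb C₁ (fun f => (η (F.symm (π f).1) * x (F.symm (π f).1)) * ε f)) :=
      FFlow.sum S₁.flow _
    convert h1 using 1
    funext e
    have h2 := congrFun (S₂.expand hx) (F e)
    simp only [Equiv.symm_apply_apply] at h2
    calc x e = η e * (η e * x e) := by rw [← mul_assoc, hηη, one_mul]
      _ = _ := by
        rw [← h2]
        simp only [comb, Finset.mul_sum]
        rw [← Equiv.sum_comp π]
        refine Finset.sum_congr rfl fun f _ => ?_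
        have h3 : C₂ (π f) (F e) = ε f * (η e * C₁ f e) := by
          rw [← hF, ← mul_assoc, hεε, one_mul]
        rw [h3]
        linear_combination (η (F.symm ↑(π f)) * x (F.symm ↑(π f)) * ε f * C₁ f e) * hηη e

end RowAux
section GraphAux

variable {V : Type} {G : SimpleGraph V} {h t : G.edgeSet → V}

lemma IsOrientation.adj (hor : IsOrientation G h t) (e : G.edgeSet) : G.Adj (h e) (t e) := by
  have := e.2
  rw [hor e] at this
  exact this

lemma flow_of_incMat [Fintype V] [DecidableEq V] [Fintype G.edgeSet] (hor : IsOrientation G h t)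
    {x : G.edgeSet → ℤ} (hx : (incMat G h t).mulVec x = 0) : FFlow h t x := by
  intro p
  have h1 : ∀ v, ∑ e, incMat G h t v e * x e = 0 := fun v => congrFun hx v
  have h2 : ∑ v, p v * ∑ e, incMat G h t v e * x e = 0 := by simp [h1]
  rw [← h2]
  simp only [Finset.mul_sum]
  rw [Finset.sum_comm]
  refine Finset.sum_congr rfl fun e _ => ?_
  rw [Fintype.sum_eq_add (h e) (t e) (hor.adj e).ne]
  · simp only [incMat, if_true, (hor.adj e).ne.symm, if_false]; ring
  · rintro v ⟨ha, hb⟩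
    simp [incMat, ha, hb]

lemma walk_flow [Fintype G.edgeSet] (hor : IsOrientation G h t) {a b : V} (w : G.Walk a b) :
    ∃ x : G.edgeSet → ℤ, FBd h t x a b ∧ (∀ e, x e ≠ 0 → e.1 ∈ w.edges) ∧
      (w.IsTrail → ∀ e, e.1 ∈ w.edges → x e ≠ 0) := by
  classical
  induction w with
  | nil => exact ⟨fun _ => 0, fun p => by simp, by simp, by simp⟩
  | @cons u v b hadj p ih =>
    obtain ⟨x, hx, hx1, hx2⟩ := ih
    let e0 : G.edgeSet := ⟨s(u, v), hadj⟩
    obtain ⟨c, hc, hcp⟩ : ∃ c : ℤ, c ≠ 0 ∧ ∀ q : V → ℤ, (q (h e0) - q (t e0)) * c = q v - q u := by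
      have h0 := hor e0
      simp only [e0, Sym2.eq_iff] at h0
      rcases h0 with ⟨h1, h2⟩ | ⟨h1, h2⟩
      · exact ⟨-1, by simp, fun q => by simp only [e0]; rw [← h1, ← h2]; ring⟩
      · exact ⟨1, by simp, fun q => by simp only [e0]; rw [← h1, ← h2]; ring⟩
    refine ⟨fun e => x e + if e = e0 then c else 0, ?_, ?_, ?_⟩
    · intro q
      simp only [mul_add, Finset.sum_add_distrib, hx q, mul_ite, mul_zero, Finset.sum_ite_eq',
        Finset.mem_univ, if_true, hcp]
      ring
    · intro e he
      rw [SimpleGraph.Walk.edges_cons, List.mem_cons]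
      by_cases h1 : e = e0
      · left; rw [h1]
      · right; exact hx1 e (by simpa [h1] using he)
    · intro htr e he
      rw [SimpleGraph.Walk.isTrail_cons] at htr
      rw [SimpleGraph.Walk.edges_cons, List.mem_cons] at he
      by_cases h1 : e = e0
      · have : x e = 0 := by
          by_contra hne
          have := hx1 e hne
          rw [h1] at this
          exact htr.2 this
        simp [h1] at this ⊢
        rw [this]; simpa using hc
      · have h2 : e.1 ∈ p.edges := by
          rcases he with he | he
          · exact absurd (Subtype.ext he) h1
          · exact he
        simpa [h1] using hx2 htr.1 e h2

lemma path_flow_zero [Fintype G.edgeSet] (hor : IsOrientation G h t) {a b : V} (w : G.Walk a b)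
    (hw : w.IsPath) {x : G.edgeSet → ℤ} (hx : FFlow h t x) (hs : ∀ e, x e ≠ 0 → e.1 ∈ w.edges) :
    x = 0 := by
  classical
  induction w with
  | nil =>
    funext e
    by_contra hne
    simpa using hs e hne
  | @cons u v b hadj p ih =>
    rw [SimpleGraph.Walk.cons_isPath_iff] at hw
    let e0 : G.edgeSet := ⟨s(u, v), hadj⟩
    have h0 : x e0 = 0 := by
      have h1 := hx (fun y => if y = u then 1 else 0)
      rw [Fintype.sum_eq_single e0] at h1
      · have h2 := hor e0
        simp only [e0, Sym2.eq_iff] at h2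
        have hne := hadj.ne
        rcases h2 with ⟨h2, h3⟩ | ⟨h2, h3⟩
        · simp only [e0, ← h2, ← h3, hne.symm, if_true, if_false] at h1
          simpa using h1
        · simp only [e0, ← h2, ← h3, hne.symm, if_true, if_false] at h1
          simpa using h1
      · intro e he
        by_cases hxe : x e = 0
        · rw [hxe, mul_zero]
        have hm := hs e hxe
        rw [SimpleGraph.Walk.edges_cons, List.mem_cons] at hm
        rcases hm with hm | hm
        · exact absurd (Subtype.ext hm) he
        · rw [hor e] at hm
          have h3 : h e ≠ u := fun h3 => hw.2 (h3 ▸ p.fst_mem_support_of_mem_edges hm)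
          have h4 : t e ≠ u := fun h4 => hw.2 (h4 ▸ p.snd_mem_support_of_mem_edges hm)
          simp [h3, h4]
    refine ih hw.1 fun e he => ?_
    have hm := hs e he
    rw [SimpleGraph.Walk.edges_cons, List.mem_cons] at hm
    rcases hm with hm | hm
    · exact absurd ((Subtype.ext hm : e = e0) ▸ h0) he
    · exact hm

lemma acyclic_flow_zero [Fintype G.edgeSet] (hor : IsOrientation G h t) {H : SimpleGraph V}
    (hH : H.IsAcyclic) {x : G.edgeSet → ℤ} (hx : FFlow h t x)
    (hs : ∀ e, x e ≠ 0 → e.1 ∈ H.edgeSet) : x = 0 := by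
  classical
  funext e
  by_contra hne
  simp only [Pi.zero_apply] at hne
  have hadj : H.Adj (h e) (t e) := by
    have := hs e hne
    rw [hor e] at this
    exact this
  have hbr := SimpleGraph.isAcyclic_iff_forall_adj_isBridge.1 hH hadj
  rw [SimpleGraph.isBridge_iff] at hbr
  have h1 := hx (fun u => if (H.deleteEdges {s(h e, t e)}).Reachable (h e) u then 1 else 0)
  rw [Fintype.sum_eq_single e] at h1
  · simp [hbr] at h1
    exact hne h1
  · intro e' he'
    by_cases hxe : x e' = 0
    · rw [hxe, mul_zero]
    have hadj' : (H.deleteEdges {s(h e, t e)}).Adj (h e') (t e') := by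
      rw [SimpleGraph.deleteEdges_adj]
      have := hs e' hxe
      rw [hor e'] at this
      refine ⟨this, fun h2 => he' (Subtype.ext ?_)⟩
      rw [hor e, hor e']
      exact h2
    have h3 : (H.deleteEdges {s(h e, t e)}).Reachable (h e) (h e') ↔
        (H.deleteEdges {s(h e, t e)}).Reachable (h e) (t e') :=
      ⟨fun h4 => h4.trans hadj'.reachable, fun h4 => h4.trans hadj'.symm.reachable⟩
    simp [h3]

/-- cycle sets are the minimal nonempty supports of flows -/
lemma isCycleSet_iff [Fintype G.edgeSet] (hor : IsOrientation G h t) (S : Set G.edgeSet) :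
    IsCycleSet G S ↔ (∃ x, FFlow h t x ∧ x ≠ 0 ∧ ∀ e, x e ≠ 0 ↔ e ∈ S) ∧
      ∀ y, FFlow h t y → y ≠ 0 → (∀ e, y e ≠ 0 → e ∈ S) → ∀ e ∈ S, y e ≠ 0 := by
  have hcyc : ∀ (S : Set G.edgeSet) (u : V) (w : G.Walk u u), w.IsCycle →
      Subtype.val '' S = {s | s ∈ w.edges} → ∃ x, FFlow h t x ∧ x ≠ 0 ∧ ∀ e, x e ≠ 0 ↔ e ∈ S := by
    intro S u w hw hS
    have hmem : ∀ e : G.edgeSet, e ∈ S ↔ e.1 ∈ w.edges := by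
      intro e
      have h1 : e.1 ∈ Subtype.val '' S ↔ e.1 ∈ w.edges := by rw [hS]; rfl
      rw [← h1]
      simp
    obtain ⟨x, hx, hx1, hx2⟩ := walk_flow hor w
    have hiff : ∀ e, x e ≠ 0 ↔ e ∈ S := fun e => by
      rw [hmem]; exact ⟨hx1 e, hx2 hw.isTrail e⟩
    refine ⟨x, hx.flow, ?_, hiff⟩
    rintro rfl
    have h3 := hw.three_le_length
    have h4 : 0 < w.edges.length := by rw [SimpleGraph.Walk.length_edges]; omega
    have h5 := List.getElem_mem h4
    have := (hiff ⟨w.edges[0], w.edges_subset_edgeSet h5⟩).2 ((hmem _).2 h5)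
    simp at this
  constructor
  · rintro ⟨u, w, hw, hS⟩
    obtain ⟨x, hx, hx0, hxS⟩ := hcyc S u w hw hS
    refine ⟨⟨x, hx, hx0, hxS⟩, fun y hy hy0 hyS => ?_⟩
    have hmem : ∀ e : G.edgeSet, e ∈ S ↔ e.1 ∈ w.edges := by
      intro e
      have h1 : e.1 ∈ Subtype.val '' S ↔ e.1 ∈ w.edges := by rw [hS]; rfl
      rw [← h1]
      simp
    cases w with
    | nil => exact absurd rfl hw.ne_nil
    | @cons _ v _ hadj p =>
      rw [SimpleGraph.Walk.cons_isCycle_iff] at hw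
      let e0 : G.edgeSet := ⟨s(u, v), hadj⟩
      have hxe0 : x e0 ≠ 0 := (hxS e0).2 ((hmem e0).2 (by simp [e0]))
      have hz := path_flow_zero hor p hw.1 ((hy.smul (x e0)).sub (hx.smul (y e0))) (by
        intro e he
        by_cases h1 : e = e0
        · subst h1; exact absurd (by ring) he
        · have h2 : e ∈ S := by
            by_contra h3
            have h4 : y e = 0 := by by_contra h; exact h3 (hyS e h)
            have h5 : x e = 0 := by by_contra h; exact h3 ((hxS e).1 h)
            exact he (by rw [h4, h5]; ring)
          have h3 := (hmem e).1 h2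
          rw [SimpleGraph.Walk.edges_cons, List.mem_cons] at h3
          rcases h3 with h3 | h3
          · exact absurd (Subtype.ext h3) h1
          · exact h3)
      have hz' : ∀ e, x e0 * y e = y e0 * x e := fun e => by
        have := congrFun hz e
        simp only [Pi.zero_apply] at this
        linarith
      have hye0 : y e0 ≠ 0 := by
        intro h0
        refine hy0 (funext fun e => ?_)
        have := hz' e
        rw [h0, zero_mul] at this
        exact (mul_eq_zero.1 this).resolve_left hxe0
      intro e he h0
      have := hz' e
      rw [h0, mul_zero] at this
      rcases mul_eq_zero.1 this.symm with h | h
      · exact hye0 h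
      · exact (hxS e).2 he h
  · rintro ⟨⟨x, hx, hx0, hxS⟩, hmin⟩
    have hna : ¬ (SimpleGraph.fromEdgeSet (Subtype.val '' S)).IsAcyclic := by
      intro hac
      refine hx0 (acyclic_flow_zero hor hac hx fun e he => ?_)
      rw [hor e, SimpleGraph.mem_edgeSet, SimpleGraph.fromEdgeSet_adj, ← hor e]
      exact ⟨⟨e, (hxS e).1 he, rfl⟩, (hor.adj e).ne⟩
    have hle : SimpleGraph.fromEdgeSet (Subtype.val '' S) ≤ G := by
      intro a b hab
      rw [SimpleGraph.fromEdgeSet_adj] at hab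
      obtain ⟨⟨e, _, he⟩, _⟩ := hab
      have := e.2
      rw [he] at this
      exact this
    unfold SimpleGraph.IsAcyclic at hna
    push Not at hna
    obtain ⟨u, w, hw⟩ := hna
    have hw' : (w.mapLe hle).IsCycle := hw.mapLe hle
    have hed : (w.mapLe hle).edges = w.edges := SimpleGraph.Walk.edges_mapLe_eq_edges ..
    have hsub : ∀ e : G.edgeSet, e.1 ∈ w.edges → e ∈ S := by
      intro e he
      have h1 := w.edges_subset_edgeSet he
      rw [SimpleGraph.edgeSet_fromEdgeSet] at h1
      obtain ⟨e', h2, h3⟩ := h1.1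
      rwa [← Subtype.ext h3]
    obtain ⟨y, hy, hy0, hyS⟩ := hcyc {e | e.1 ∈ w.edges} u _ hw' (by
      rw [hed]
      ext s
      simp only [Set.mem_image, Set.mem_setOf_eq]
      constructor
      · rintro ⟨e, he, rfl⟩; exact he
      · intro hs
        exact ⟨⟨s, by
          have := (w.mapLe hle).edges_subset_edgeSet (e := s) (by rw [hed]; exact hs)
          exact this⟩, hs, rfl⟩)
    refine ⟨u, _, hw', ?_⟩
    rw [hed]
    ext s
    simp only [Set.mem_image, Set.mem_setOf_eq]
    constructor
    · rintro ⟨e, he, rfl⟩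
      have := hmin y hy hy0 (fun e he => hsub e ((hyS e).1 he)) e he
      exact (hyS e).1 this
    · intro hs
      have h1 : s ∈ G.edgeSet :=
        (w.mapLe hle).edges_subset_edgeSet (e := s) (by rw [hed]; exact hs)
      exact ⟨⟨s, h1⟩, hsub ⟨s, h1⟩ hs, rfl⟩

lemma tree_le (T : Set G.edgeSet) : SimpleGraph.fromEdgeSet (Subtype.val '' T) ≤ G := by
  intro a b hab
  rw [SimpleGraph.fromEdgeSet_adj] at hab
  obtain ⟨⟨e, _, he⟩, _⟩ := hab
  have := e.2
  rw [he] at this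
  exact this

lemma tree_edgeSet (T : Set G.edgeSet) :
    (SimpleGraph.fromEdgeSet (Subtype.val '' T)).edgeSet = Subtype.val '' T := by
  rw [SimpleGraph.edgeSet_fromEdgeSet]
  refine Set.Subset.antisymm Set.diff_subset ?_
  rintro s ⟨e, he, rfl⟩
  refine ⟨⟨e, he, rfl⟩, fun hd => ?_⟩
  exact G.not_isDiag_of_mem_edgeSet e.2 (by simpa using hd)

lemma tree_conn [Fintype V] [Fintype G.edgeSet] (hor : IsOrientation G h t) {T : Set G.edgeSet}
    (hT : IsSpanningTree G T) (a b : V) :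
    ∃ g : G.edgeSet → ℤ, FBd h t g a b ∧ ∀ e, e ∉ T → g e = 0 := by
  obtain ⟨w⟩ := hT.1.preconnected a b
  obtain ⟨x, hx, hx1, _⟩ := walk_flow hor (w.mapLe (tree_le T))
  refine ⟨x, hx, fun e he => ?_⟩
  by_contra hne
  have h1 := hx1 e hne
  rw [SimpleGraph.Walk.edges_mapLe_eq_edges] at h1
  have h2 := w.edges_subset_edgeSet h1
  rw [tree_edgeSet] at h2
  obtain ⟨e', h3, h4⟩ := h2
  exact he (Subtype.ext h4 ▸ h3)

lemma tree_zero [Fintype V] [Fintype G.edgeSet] (hor : IsOrientation G h t) {T : Set G.edgeSet}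
    (hT : IsSpanningTree G T) (x : G.edgeSet → ℤ) (hx : FFlow h t x)
    (hs : ∀ e, e ∉ T → x e = 0) : x = 0 := by
  have htree : (SimpleGraph.fromEdgeSet (Subtype.val '' T)).IsTree := by
    rw [SimpleGraph.isTree_iff_connected_and_card]
    refine ⟨hT.1, ?_⟩
    rw [tree_edgeSet, Nat.card_coe_set_eq, Set.ncard_image_of_injective _ Subtype.val_injective,
      hT.2, Nat.card_eq_fintype_card]
  refine acyclic_flow_zero hor htree.isAcyclic hx fun e he => ?_
  rw [tree_edgeSet]
  exact ⟨e, by by_contra h; exact he (hs e h), rfl⟩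

lemma row_ne_zero [Fintype V] [Fintype G.edgeSet] (hor : IsOrientation G h t) {T : Set G.edgeSet}
    {C : {e : G.edgeSet // e ∉ T} → G.edgeSet → ℤ} (S : FSys h t T C) (h2 : TwoEdgeConnected G)
    (e : G.edgeSet) : ∃ f, C f e ≠ 0 := by
  classical
  obtain ⟨w⟩ := (h2.2.2 e.1 e.2).preconnected (h e) (t e)
  have hle : G.deleteEdges {e.1} ≤ G := SimpleGraph.deleteEdges_le _
  obtain ⟨x, hx, hx1, _⟩ := walk_flow hor (w.mapLe hle)
  have hxe : x e = 0 := by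
    by_contra hne
    have h1 := hx1 e hne
    rw [SimpleGraph.Walk.edges_mapLe_eq_edges] at h1
    have h2 := w.edges_subset_edgeSet h1
    rw [SimpleGraph.edgeSet_deleteEdges] at h2
    exact h2.2 rfl
  have hfl : FFlow h t (fun e' => x e' + if e' = e then 1 else 0) := by
    intro q
    simp only [mul_add, Finset.sum_add_distrib, hx q, mul_ite, mul_zero, Finset.sum_ite_eq',
      Finset.mem_univ, if_true]
    ring
  by_contra hcon
  push Not at hcon
  have := congrFun (S.expand hfl) e
  simp [comb, hcon, hxe] at this

end GraphAux
section LaurentAux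

/-- All coefficients below `a` vanish. -/
def LLow (a : ℤ) (p : LaurentPolynomial ℤ) : Prop := ∀ n, n < a → p.coeff n = 0

lemma LLow.mono {a b : ℤ} {p : LaurentPolynomial ℤ} (hp : LLow a p) (hba : b ≤ a) : LLow b p :=
  fun n hn => hp n (by omega)

lemma LLow.mul {a b : ℤ} {p q : LaurentPolynomial ℤ} (hp : LLow a p) (hq : LLow b q) :
    LLow (a + b) (p * q) := by
  intro n hn
  rw [AddMonoidAlgebra.coeff_mul]
  refine Finset.sum_eq_zero fun i hi => Finset.sum_eq_zero fun j hj => ?_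
  rw [Finsupp.mem_support_iff] at hi hj
  have h1 : ¬ i < a := fun h => hi (hp i h)
  have h2 : ¬ j < b := fun h => hj (hq j h)
  exact if_neg (by omega)

lemma LLow.mul_coeff {a b : ℤ} {p q : LaurentPolynomial ℤ} (hp : LLow a p) (hq : LLow b q) :
    (p * q).coeff (a + b) = p.coeff a * q.coeff b := by
  rw [AddMonoidAlgebra.coeff_mul]
  unfold Finsupp.sum
  beta_reduce
  rw [Finset.sum_eq_single a, Finset.sum_eq_single b]
  · simp
  · intro j hj hjb
    exact if_neg (by omega)
  · intro hb
    rw [Finsupp.notMem_support_iff] at hb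
    simp [hb]
  · intro i hi hia
    refine Finset.sum_eq_zero fun j hj => ?_
    rw [Finsupp.mem_support_iff] at hi hj
    have h1 : ¬ i < a := fun h => hi (hp i h)
    have h2 : ¬ j < b := fun h => hj (hq j h)
    exact if_neg (by omega)
  · intro ha
    rw [Finsupp.notMem_support_iff] at ha
    simp [ha]

lemma lcoeff_sum {ι : Type} (s : Finset ι) (p : ι → LaurentPolynomial ℤ) (n : ℤ) :
    (∑ i ∈ s, p i).coeff n = ∑ i ∈ s, (p i).coeff n := by
  classical
  induction s using Finset.induction_on with
  | empty => simp
  | insert a s ha ih => rw [Finset.sum_insert ha, Finset.sum_insert ha, ← ih]; simp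

lemma LLow.sum {ι : Type} {s : Finset ι} {p : ι → LaurentPolynomial ℤ} {a : ℤ}
    (hp : ∀ i, LLow a (p i)) : LLow a (∑ i ∈ s, p i) := by
  intro n hn
  rw [lcoeff_sum]
  exact Finset.sum_eq_zero fun i _ => hp i n hn

lemma lcoeff_int (m n : ℤ) : ((m : ℤ) : LaurentPolynomial ℤ).coeff n = if n = 0 then m else 0 := by
  have : ((m : ℤ) : LaurentPolynomial ℤ) = LaurentPolynomial.C m := by simp
  rw [this, LaurentPolynomial.C_apply]

lemma LLow.int (m : ℤ) : LLow 0 ((m : ℤ) : LaurentPolynomial ℤ) := by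
  intro n hn
  rw [lcoeff_int, if_neg (by omega)]

lemma LLow.T (m : ℤ) : LLow m (LaurentPolynomial.T m) := by
  intro n hn
  rw [LaurentPolynomial.T_apply, if_neg (by omega)]

lemma exists_llow (p : LaurentPolynomial ℤ) : ∃ N : ℕ, LLow (-(N : ℤ)) p := by
  refine ⟨∑ i ∈ p.coeff.support, i.natAbs, fun n hn => ?_⟩
  by_contra h
  have := Finset.single_le_sum (f := fun i : ℤ => i.natAbs) (fun _ _ => Nat.zero_le _)
    (Finsupp.mem_support_iff.2 h)
  omega

lemma exists_llow_fam {ι : Type} [Fintype ι] (p : ι → LaurentPolynomial ℤ) :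
    ∃ N : ℕ, ∀ i, LLow (-(N : ℤ)) (p i) := by
  choose N hN using fun i => exists_llow (p i)
  refine ⟨∑ i, N i, fun i => (hN i).mono ?_⟩
  have := Finset.single_le_sum (f := N) (fun _ _ => Nat.zero_le _) (Finset.mem_univ i)
  omega

lemma llow_zero {ι : Type} [Fintype ι] (p : ι → LaurentPolynomial ℤ) (M : ι → ι → ℤ) (m : ℤ)
    (heq : ∑ i, p i * p i + LaurentPolynomial.T 2 * ∑ i, ∑ j, (M i j : LaurentPolynomial ℤ)
      * (p i * p j) = 1 + (m : LaurentPolynomial ℤ) * LaurentPolynomial.T 2) :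
    ∀ i, LLow 0 (p i) := by
  obtain ⟨N, hN⟩ := exists_llow_fam p
  induction N with
  | zero => simpa using hN
  | succ N ih =>
    apply ih
    set d : ℤ := -((N + 1 : ℕ) : ℤ) with hd
    have hco := congrArg (fun q : LaurentPolynomial ℤ => q.coeff (d + d)) heq
    have h1 : (LaurentPolynomial.T 2 * ∑ i, ∑ j, (M i j : LaurentPolynomial ℤ)
      * (p i * p j)).coeff (d + d) = 0 :=
      (LLow.mul (LLow.T 2) (LLow.sum fun i => LLow.sum fun j =>
        LLow.mul (LLow.int (M i j)) ((hN i).mul (hN j)))) _ (by omega)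
    have h2 : ((m : LaurentPolynomial ℤ) * LaurentPolynomial.T 2).coeff (d + d) = 0 :=
      (LLow.mul (LLow.int m) (LLow.T 2)) _ (by omega)
    have h3 : (1 : LaurentPolynomial ℤ).coeff (d + d) = 0 := by
      have := LLow.int 1 (d + d) (by omega)
      simpa using this
    have h4 : (∑ i, p i * p i).coeff (d + d) = ∑ i, (p i).coeff d * (p i).coeff d := by
      rw [lcoeff_sum]
      exact Finset.sum_congr rfl fun i _ => (hN i).mul_coeff (hN i)
    simp only [AddMonoidAlgebra.coeff_add, Finsupp.add_apply, h1, h2, h3, h4, add_zero] at hco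
    rw [Finset.sum_eq_zero_iff_of_nonneg (fun i _ => mul_self_nonneg _)] at hco
    intro i n hn
    by_cases hnd : n < d
    · exact hN i n hnd
    · have : n = d := by omega
      rw [this]
      exact mul_self_eq_zero.1 (hco i (Finset.mem_univ i))

lemma sigma_coeff (σ : LaurentPolynomial ℤ →+* LaurentPolynomial ℤ)
    (hσ : σ (LaurentPolynomial.T 1) = LaurentPolynomial.T (-1)) (p : LaurentPolynomial ℤ) (n : ℤ) :
    (σ p).coeff n = p.coeff (-n) := by
  have hT : ∀ n : ℕ, σ (LaurentPolynomial.T n) = LaurentPolynomial.T (-n) := by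
    intro n
    have := LaurentPolynomial.T_pow (R := ℤ) 1 n
    rw [mul_one] at this
    rw [← this, map_pow, hσ, LaurentPolynomial.T_pow]
    simp
  have hT' : ∀ n : ℕ, σ (LaurentPolynomial.T (-(n : ℤ))) = LaurentPolynomial.T n := by
    intro n
    have h1 : (LaurentPolynomial.T n * LaurentPolynomial.T (-(n : ℤ)) : LaurentPolynomial ℤ) = 1 := by
      rw [← LaurentPolynomial.T_add]; simp
    have h2 := congrArg σ h1
    rw [map_mul, hT, map_one] at h2
    calc _ = LaurentPolynomial.T n * LaurentPolynomial.T (-(n : ℤ)) *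
          σ (LaurentPolynomial.T (-(n : ℤ))) := by rw [h1, one_mul]
      _ = _ := by rw [mul_assoc, h2, mul_one]
  have hZ : ∀ n : ℤ, σ (LaurentPolynomial.T n) = LaurentPolynomial.T (-n) := by
    intro n
    rcases Int.eq_nat_or_neg n with ⟨k, rfl | rfl⟩
    · exact hT k
    · rw [hT' k, neg_neg]
  have : σ p = LaurentPolynomial.invert p := by
    induction p using LaurentPolynomial.induction_on' with
    | add p q hp hq => rw [map_add, map_add, hp, hq]
    | C_mul_T n a =>
      rw [map_mul, map_mul, hZ, LaurentPolynomial.invert_T, LaurentPolynomial.invert_C]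
      have : (LaurentPolynomial.C a : LaurentPolynomial ℤ) = (a : LaurentPolynomial ℤ) := by simp
      rw [this, map_intCast]
  rw [this, LaurentPolynomial.invert_apply]

lemma exists_int (σ : LaurentPolynomial ℤ →+* LaurentPolynomial ℤ)
    (hσ : σ (LaurentPolynomial.T 1) = LaurentPolynomial.T (-1)) (p : LaurentPolynomial ℤ)
    (hp : σ p = p) (hl : LLow 0 p) : ∃ c : ℤ, p = (c : LaurentPolynomial ℤ) := by
  refine ⟨p.coeff 0, LaurentPolynomial.ext fun n => ?_⟩
  rw [lcoeff_int]
  rcases lt_trichotomy n 0 with h | h | h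
  · rw [if_neg h.ne, hl n h]
  · rw [if_pos h, h]
  · rw [if_neg h.ne', ← hp, sigma_coeff σ hσ, hl _ (by omega)]

lemma int_T_inj {a b c d : ℤ} (heq : (a : LaurentPolynomial ℤ) + (b : LaurentPolynomial ℤ)
    * LaurentPolynomial.T 2 = (c : LaurentPolynomial ℤ) + (d : LaurentPolynomial ℤ)
    * LaurentPolynomial.T 2) : a = c ∧ b = d := by
  have key : ∀ a b : ℤ, ((a : LaurentPolynomial ℤ) + (b : LaurentPolynomial ℤ)
    * LaurentPolynomial.T 2).coeff 0 = a ∧ ((a : LaurentPolynomial ℤ) + (b : LaurentPolynomial ℤ)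
    * LaurentPolynomial.T 2).coeff 2 = b := by
    intro a b
    constructor
    · rw [AddMonoidAlgebra.coeff_add, Finsupp.add_apply, lcoeff_int,
        ((LLow.int b).mul (LLow.T 2)) 0 (by norm_num)]
      simp
    · have := (LLow.int b).mul_coeff (LLow.T 2)
      rw [zero_add] at this
      rw [AddMonoidAlgebra.coeff_add, Finsupp.add_apply, lcoeff_int, this, lcoeff_int]
      simp
  have h1 := key a b
  have h2 := key c d
  rw [heq] at h1
  exact ⟨h1.1.symm.trans h2.1, h1.2.symm.trans h2.2⟩

lemma sum_sq_one {ι : Type} [Fintype ι] (c : ι → ℤ) (hc : ∑ i, c i * c i = 1) :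
    ∃ i, (c i = 1 ∨ c i = -1) ∧ ∀ j, j ≠ i → c j = 0 := by
  classical
  have hne : ∃ i, c i ≠ 0 := by
    by_contra h
    push Not at h
    simp [h] at hc
  obtain ⟨i, hi⟩ := hne
  have h1 : 1 ≤ c i * c i := by
    have := mul_self_pos.2 hi
    omega
  rw [← Finset.add_sum_erase _ _ (Finset.mem_univ i)] at hc
  have h2 : 0 ≤ ∑ j ∈ Finset.univ.erase i, c j * c j :=
    Finset.sum_nonneg fun j _ => mul_self_nonneg _
  have h3 : ∑ j ∈ Finset.univ.erase i, c j * c j = 0 := by omega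
  refine ⟨i, ?_, fun j hj => ?_⟩
  · exact mul_self_eq_one_iff.1 (by omega)
  · rw [Finset.sum_eq_zero_iff_of_nonneg (fun j _ => mul_self_nonneg _)] at h3
    exact mul_self_eq_zero.1 (h3 j (Finset.mem_erase.2 ⟨hj, Finset.mem_univ j⟩))

end LaurentAux
section FormAux

lemma gram_eq {V : Type} [DecidableEq V] (G : SimpleGraph V)
    [Fintype G.edgeSet] (T : Set G.edgeSet)
    (C : {e : G.edgeSet // e ∉ T} → G.edgeSet → ℤ) (f g : {e : G.edgeSet // e ∉ T}) :
    qFlowGram G T C f g = (((if f = g then 1 else 0 : ℤ)) : LaurentPolynomial ℤ) +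
      (((∑ e, C f e * C g e) - (if f = g then 1 else 0) : ℤ) : LaurentPolynomial ℤ) *
        LaurentPolynomial.T 2 := by
  unfold qFlowGram
  by_cases h : f = g
  · subst h; simp
  · simp [h]

lemma form_rigid (σ : LaurentPolynomial ℤ →+* LaurentPolynomial ℤ)
    (hσ : σ (LaurentPolynomial.T 1) = LaurentPolynomial.T (-1))
    {ι κ : Type} [Fintype ι] [Fintype κ] [DecidableEq ι] [DecidableEq κ]
    (M : ι → ι → ℤ) (N : κ → κ → ℤ)
    (φ : (ι → LaurentPolynomial ℤ) ≃ₗ[LaurentPolynomial ℤ] (κ → LaurentPolynomial ℤ))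
    (h1 : ∀ x y, (∑ f, ∑ g, σ (φ x f) * (((if f = g then 1 else 0 : ℤ) : LaurentPolynomial ℤ)
        + ((N f g - (if f = g then 1 else 0) : ℤ) : LaurentPolynomial ℤ)
        * LaurentPolynomial.T 2) * φ y g)
      = ∑ f, ∑ g, σ (x f) * (((if f = g then 1 else 0 : ℤ) : LaurentPolynomial ℤ)
        + ((M f g - (if f = g then 1 else 0) : ℤ) : LaurentPolynomial ℤ)
        * LaurentPolynomial.T 2) * y g)
    (h2 : ∀ x, φ (fun f => σ (x f)) = fun g => σ (φ x g)) :
    ∃ (π : ι ≃ κ) (ε : ι → ℤ), (∀ f, ε f = 1 ∨ ε f = -1) ∧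
      ∀ f g, M f g = ε f * ε g * N (π f) (π g) := by
  classical
  set p : ι → κ → LaurentPolynomial ℤ := fun f => φ (Pi.single f 1) with hp
  have hpσ : ∀ f h, σ (p f h) = p f h := by
    intro f h
    have := congrFun (h2 (Pi.single f 1)) h
    have h3 : (fun g => σ ((Pi.single f 1 : ι → LaurentPolynomial ℤ) g)) = Pi.single f 1 := by
      funext g
      by_cases hg : g = f
      · subst hg; simp
      · simp [hg]
    rw [h3] at this
    exact this.symm
  have hform : ∀ f g, ∑ i, p f i * p g i + LaurentPolynomial.T 2 * ∑ i, ∑ j,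
      ((N i j - (if i = j then 1 else 0) : ℤ) : LaurentPolynomial ℤ) * (p f i * p g j)
      = ((if f = g then 1 else 0 : ℤ) : LaurentPolynomial ℤ)
        + ((M f g - (if f = g then 1 else 0) : ℤ) : LaurentPolynomial ℤ)
        * LaurentPolynomial.T 2 := by
    intro f g
    have := h1 (Pi.single f 1) (Pi.single g 1)
    have hR : (∑ a, ∑ b, σ ((Pi.single f 1 : ι → LaurentPolynomial ℤ) a) *
        (((if a = b then 1 else 0 : ℤ) : LaurentPolynomial ℤ)
        + ((M a b - (if a = b then 1 else 0) : ℤ) : LaurentPolynomial ℤ)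
        * LaurentPolynomial.T 2) * (Pi.single g 1 : ι → LaurentPolynomial ℤ) b)
        = ((if f = g then 1 else 0 : ℤ) : LaurentPolynomial ℤ)
        + ((M f g - (if f = g then 1 else 0) : ℤ) : LaurentPolynomial ℤ)
        * LaurentPolynomial.T 2 := by
      rw [Fintype.sum_eq_single f, Fintype.sum_eq_single g]
      · simp
      · intro b hb; simp [hb]
      · intro a ha; simp [ha]
    rw [hR] at this
    rw [← this, Finset.mul_sum, ← Finset.sum_add_distrib]
    refine Finset.sum_congr rfl fun i _ => ?_
    have hd : p f i * p g i = ∑ j, ((if i = j then 1 else 0 : ℤ) : LaurentPolynomial ℤ)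
        * (p f i * p g j) := by
      rw [Fintype.sum_eq_single i]
      · simp
      · intro j hj; simp [hj.symm]
    rw [hd, Finset.mul_sum, ← Finset.sum_add_distrib]
    refine Finset.sum_congr rfl fun j _ => ?_
    have e1 : σ (φ (Pi.single f 1) i) = p f i := hpσ f i
    have e2 : φ (Pi.single g 1) j = p g j := rfl
    rw [e1, e2]
    ring
  have hc : ∀ f h, ∃ c : ℤ, p f h = (c : LaurentPolynomial ℤ) := by
    intro f h
    refine exists_int σ hσ _ (hpσ f h) (llow_zero (p f)
      (fun i j => N i j - (if i = j then 1 else 0)) (M f f - 1) ?_ h)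
    · rw [hform f f]
      simp
  choose c hc using hc
  have hcf : ∀ f g, ∑ i, c f i * c g i = (if f = g then 1 else 0) ∧
      ∑ i, ∑ j, (N i j - (if i = j then 1 else 0)) * (c f i * c g j)
        = M f g - (if f = g then 1 else 0) := by
    intro f g
    have := hform f g
    simp only [hc] at this
    apply int_T_inj
    rw [← this]
    push_cast
    ring
  choose π hπ using fun f => sum_sq_one (c f) (by have := (hcf f f).1; simpa using this)
  have hsum : ∀ f (u : κ → ℤ), ∑ i, c f i * u i = c f (π f) * u (π f) := by
    intro f u
    rw [Fintype.sum_eq_single (π f)]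
    intro j hj
    rw [(hπ f).2 j hj, zero_mul]
  have hinj : Function.Injective π := by
    intro f g hfg
    by_contra hne
    have := (hcf f g).1
    rw [if_neg hne, hsum, hfg] at this
    have h1 := (hπ f).1
    have h2 := (hπ g).1
    rw [hfg] at h1
    rcases h1 with h1 | h1 <;> rcases h2 with h2 | h2 <;> rw [h1, h2] at this <;> norm_num at this
  have hcard : Fintype.card ι = Fintype.card κ := by
    have := φ.finrank_eq
    simpa using this
  have hbij : Function.Bijective π := (Fintype.bijective_iff_injective_and_card π).2 ⟨hinj, hcard⟩
  refine ⟨Equiv.ofBijective π hbij, fun f => c f (π f), fun f => (hπ f).1, fun f g => ?_⟩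
  have := (hcf f g).2
  have e : ∑ i, ∑ j, (N i j - (if i = j then 1 else 0)) * (c f i * c g j)
      = c f (π f) * (c g (π g) * (N (π f) (π g) - (if π f = π g then 1 else 0))) := by
    rw [← hsum g fun j => N (π f) j - (if π f = j then 1 else 0),
      ← hsum f fun i => ∑ j, c g j * (N i j - (if i = j then 1 else 0))]
    refine Finset.sum_congr rfl fun i _ => ?_
    rw [Finset.mul_sum]
    exact Finset.sum_congr rfl fun j _ => by ring
  rw [e] at this
  simp only [Equiv.ofBijective_apply]
  by_cases hfg : f = g
  · subst hfg
    simp only [if_true] at this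
    have h1 : c f (π f) * c f (π f) = 1 := by
      rcases (hπ f).1 with h | h <;> rw [h] <;> norm_num
    linear_combination -this - h1
  · rw [if_neg hfg, if_neg (fun h => hfg (hinj h))] at this
    linear_combination -this

end FormAux
section MainAux

/-- `S` is a minimal nonempty support of a flow. -/
def FCirc {V E : Type} [Fintype E] (h t : E → V) (S : Set E) : Prop :=
  (∃ x : E → ℤ, FFlow h t x ∧ x ≠ 0 ∧ ∀ e, x e ≠ 0 ↔ e ∈ S) ∧
    ∀ y : E → ℤ, FFlow h t y → y ≠ 0 → (∀ e, y e ≠ 0 → e ∈ S) → ∀ e ∈ S, y e ≠ 0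

lemma FCirc.transport {V₁ V₂ E₁ E₂ : Type} [Fintype E₁] [Fintype E₂]
    {h₁ t₁ : E₁ → V₁} {h₂ t₂ : E₂ → V₂} (F : E₁ ≃ E₂) (η : E₁ → ℤ) (hη : ∀ e, η e ≠ 0)
    (hf : ∀ x, FFlow h₁ t₁ x → FFlow h₂ t₂ (fun e => η (F.symm e) * x (F.symm e)))
    (hb : ∀ y, FFlow h₂ t₂ y → FFlow h₁ t₁ (fun e => η e * y (F e)))
    {S : Set E₁} (hS : FCirc h₁ t₁ S) : FCirc h₂ t₂ (F '' S) := by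
  obtain ⟨⟨x, hx, hx0, hxs⟩, hmin⟩ := hS
  refine ⟨⟨_, hf x hx, ?_, ?_⟩, ?_⟩
  · intro h0
    apply hx0
    funext e
    have := congrFun h0 (F e)
    simpa [hη] using this
  · intro e
    rw [Equiv.image_eq_preimage_symm, Set.mem_preimage, ← hxs]
    simp [hη]
  · intro y hy hy0 hys e he
    obtain ⟨e, he, rfl⟩ := he
    have := hmin _ (hb y hy) (fun h0 => hy0 (by
      funext e
      have := congrFun h0 (F.symm e)
      simpa [hη] using this)) (fun e' he' => by
        have := hys (F e') (right_ne_zero_of_mul he')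
        obtain ⟨e'', h1, h2⟩ := this
        exact F.injective h2 ▸ h1) e he
    exact right_ne_zero_of_mul this

lemma FCirc.transport_iff {V₁ V₂ E₁ E₂ : Type} [Fintype E₁] [Fintype E₂]
    {h₁ t₁ : E₁ → V₁} {h₂ t₂ : E₂ → V₂} (F : E₁ ≃ E₂) (η : E₁ → ℤ)
    (hη : ∀ e, η e = 1 ∨ η e = -1)
    (hf : ∀ x, FFlow h₁ t₁ x ↔ FFlow h₂ t₂ (fun e => η (F.symm e) * x (F.symm e)))
    (S : Set E₁) : FCirc h₁ t₁ S ↔ FCirc h₂ t₂ (F '' S) := by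
  have hηη : ∀ f, η f * η f = 1 := fun f => by rcases hη f with h | h <;> simp [h]
  have hη0 : ∀ f, η f ≠ 0 := fun f => by rcases hη f with h | h <;> simp [h]
  have hb : ∀ y, FFlow h₂ t₂ y → FFlow h₁ t₁ (fun e => η e * y (F e)) := by
    intro y hy
    rw [hf]
    convert hy using 2 with e
    rw [← mul_assoc, hηη, one_mul, Equiv.apply_symm_apply]
  refine ⟨fun h => FCirc.transport F η hη0 (fun x => (hf x).1) hb h, fun h => ?_⟩
  have := FCirc.transport F.symm (fun e => η (F.symm e)) (fun e => hη0 _)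
    (fun x hx => by simpa using hb x hx) (fun y hy => (hf y).1 hy) h
  rwa [Equiv.symm_image_image] at this

lemma FSys.circ {V E : Type} [Fintype E] {h t : E → V} {T : Set E}
    {C : {e : E // e ∉ T} → E → ℤ} (S : FSys h t T C) (f : {e : E // e ∉ T}) :
    FCirc h t {e | C f e ≠ 0} := by
  refine ⟨⟨C f, S.flow f, fun h0 => ?_, fun e => Iff.rfl⟩, fun y hy hy0 hys e he => ?_⟩
  · have := congrFun h0 f.1
    rw [S.one] at this
    simp at this
  · have hsg := S.single f hy (fun e he hne => by
      by_contra h0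
      exact hys e h0 (S.supp f e he hne))
    rw [hsg e]
    refine mul_ne_zero (fun h0 => hy0 ?_) he
    funext e
    rw [hsg e, h0, zero_mul, Pi.zero_apply]

lemma FSys.circ_eq {V E : Type} [Fintype E] {h t : E → V} {T : Set E}
    {C : {e : E // e ∉ T} → E → ℤ} (S : FSys h t T C) (f : {e : E // e ∉ T}) {A : Set E}
    (hA : FCirc h t A) (hs : ∀ e ∈ A, e ∉ T → e = f.1) (e : E) : e ∈ A ↔ C f e ≠ 0 := by
  obtain ⟨⟨x, hx, hx0, hxs⟩, _⟩ := hA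
  have hsg := S.single f hx (fun e he hne => by
    by_contra h0
    exact hne (hs e ((hxs e).1 h0) he))
  have hf0 : x f.1 ≠ 0 := fun h0 => hx0 (by
    funext e
    rw [hsg e, h0, zero_mul, Pi.zero_apply])
  rw [← hxs, hsg e]
  simp [hf0]

end MainAux

/-- q-analog of the Su–Wagner/Caporaso–Viviani theorem, flow version.
For `i = 1,2`, let `Γᵢ` be a finite 2-edge-connected oriented simple graph with spanning
tree `Tᵢ` and fundamental cycles `Cᵢ`.  Then the q-flow lattices of `(Γ₁,T₁)` and
`(Γ₂,T₂)` are isomorphic (as `R = ℤ[q,q⁻¹]`-modules with a form, compatibly with the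
bar involutions fixing the fundamental-cycle bases) if and only if there is a
cycle-preserving bijection `F : E₁ → E₂` with `F(T₁) = T₂`. -/
theorem stmt11
    (σ : LaurentPolynomial ℤ →+* LaurentPolynomial ℤ)
    (hσ : σ (LaurentPolynomial.T 1) = LaurentPolynomial.T (-1))
    (V₁ V₂ : Type) [Fintype V₁] [Fintype V₂] [DecidableEq V₁] [DecidableEq V₂]
    (G₁ : SimpleGraph V₁) (G₂ : SimpleGraph V₂)
    [Fintype G₁.edgeSet] [Fintype G₂.edgeSet]
    (head₁ tail₁ : G₁.edgeSet → V₁) (head₂ tail₂ : G₂.edgeSet → V₂)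
    (hor₁ : IsOrientation G₁ head₁ tail₁) (hor₂ : IsOrientation G₂ head₂ tail₂)
    (h2ec₁ : TwoEdgeConnected G₁) (h2ec₂ : TwoEdgeConnected G₂)
    (T₁ : Set G₁.edgeSet) (T₂ : Set G₂.edgeSet)
    [DecidablePred (· ∈ T₁)] [DecidablePred (· ∈ T₂)]
    (hT₁ : IsSpanningTree G₁ T₁) (hT₂ : IsSpanningTree G₂ T₂)
    (C₁ : {e : G₁.edgeSet // e ∉ T₁} → G₁.edgeSet → ℤ)
    (C₂ : {e : G₂.edgeSet // e ∉ T₂} → G₂.edgeSet → ℤ)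
    (hC₁ker : ∀ f, (incMat G₁ head₁ tail₁).mulVec (C₁ f) = 0)
    (hC₁f : ∀ f, C₁ f f.val = 1)
    (hC₁supp : ∀ f (e : G₁.edgeSet), e ∉ T₁ → e ≠ f.val → C₁ f e = 0)
    (hC₂ker : ∀ f, (incMat G₂ head₂ tail₂).mulVec (C₂ f) = 0)
    (hC₂f : ∀ f, C₂ f f.val = 1)
    (hC₂supp : ∀ f (e : G₂.edgeSet), e ∉ T₂ → e ≠ f.val → C₂ f e = 0) :
    (∃ φ : ({e : G₁.edgeSet // e ∉ T₁} → LaurentPolynomial ℤ) ≃ₗ[LaurentPolynomial ℤ]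
        ({e : G₂.edgeSet // e ∉ T₂} → LaurentPolynomial ℤ),
      (∀ x y, (∑ f, ∑ g, σ (φ x f) * qFlowGram G₂ T₂ C₂ f g * φ y g)
          = ∑ f, ∑ g, σ (x f) * qFlowGram G₁ T₁ C₁ f g * y g) ∧
      (∀ x, φ (fun f => σ (x f)) = fun g => σ (φ x g)))
    ↔ (∃ F : G₁.edgeSet ≃ G₂.edgeSet,
        (∀ S : Set G₁.edgeSet, IsCycleSet G₁ S ↔ IsCycleSet G₂ (⇑F '' S)) ∧
        ⇑F '' T₁ = T₂) := by
  classical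
  have S₁ : FSys head₁ tail₁ T₁ C₁ :=
    ⟨tree_zero hor₁ hT₁, fun f => flow_of_incMat hor₁ (hC₁ker f), hC₁f, hC₁supp⟩
  have S₂ : FSys head₂ tail₂ T₂ C₂ :=
    ⟨tree_zero hor₂ hT₂, fun f => flow_of_incMat hor₂ (hC₂ker f), hC₂f, hC₂supp⟩
  constructor
  · rintro ⟨φ, hφ, hφσ⟩
    simp only [gram_eq] at hφ
    obtain ⟨π, ε, hε, hgram⟩ := form_rigid σ hσ (fun f g => ∑ e, C₁ f e * C₁ g e)
      (fun f g => ∑ e, C₂ f e * C₂ g e) φ hφ hφσ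
    obtain ⟨F, η, hη, hFT, hF⟩ := exists_edge_equiv S₁ S₂ (row_ne_zero hor₁ S₁ h2ec₁)
      (row_ne_zero hor₂ S₂ h2ec₂) π ε hε hgram
    refine ⟨F, fun S => ?_, ?_⟩
    · rw [isCycleSet_iff hor₁, isCycleSet_iff hor₂]
      exact FCirc.transport_iff F η hη (flow_transport S₁ S₂ π ε hε F η hη hF) S
    · ext e
      rw [Equiv.image_eq_preimage_symm, Set.mem_preimage, hFT, Equiv.apply_symm_apply]
  · rintro ⟨F, hcyc, hFT⟩
    have hF : ∀ e, e ∉ T₁ ↔ F e ∉ T₂ := by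
      intro e
      rw [← hFT, F.injective.mem_set_image]
    have hsupp : ∀ (f : {e : G₁.edgeSet // e ∉ T₁}) (e : G₁.edgeSet),
        C₁ f e ≠ 0 ↔ C₂ ⟨F f.1, (hF f.1).1 f.2⟩ (F e) ≠ 0 := by
      intro f e
      have h1 : IsCycleSet G₁ {e | C₁ f e ≠ 0} := (isCycleSet_iff hor₁ _).2 (S₁.circ f)
      have h2 : FCirc head₂ tail₂ (F '' {e | C₁ f e ≠ 0}) :=
        (isCycleSet_iff hor₂ _).1 ((hcyc _).1 h1)
      rw [← S₂.circ_eq ⟨F f.1, (hF f.1).1 f.2⟩ h2 ?_ (F e), F.injective.mem_set_image]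
      · rfl
      · rintro _ ⟨e', he', rfl⟩ hnT
        by_contra hne
        exact he' (S₁.supp f e' ((hF e').2 hnT) (fun h => hne (congrArg F h)))
    obtain ⟨r₁⟩ := h2ec₁.1.nonempty
    obtain ⟨r₂⟩ := h2ec₂.1.nonempty
    obtain ⟨η, hη, hC⟩ := exists_signs S₁ S₂ r₁ r₂
      (fun u => (tree_conn hor₁ hT₁ r₁ u).imp fun g hg => hg.1)
      (fun u => tree_conn hor₂ hT₂ r₂ u) (fun e => (hor₂.adj e).ne) F hF hsupp
    have hηη : ∀ f, η f * η f = 1 := fun f => by rcases hη f with h | h <;> simp [h]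
    let π : {e : G₁.edgeSet // e ∉ T₁} ≃ {e : G₂.edgeSet // e ∉ T₂} := F.subtypeEquiv hF
    have hgram : ∀ f g, ∑ e, C₂ (π f) e * C₂ (π g) e = η f.1 * η g.1 * ∑ e, C₁ f e * C₁ g e := by
      intro f g
      rw [← Equiv.sum_comp F, Finset.mul_sum]
      refine Finset.sum_congr rfl fun e _ => ?_
      have e1 : C₂ (π f) (F e) = _ := hC f e
      have e2 : C₂ (π g) (F e) = _ := hC g e
      rw [e1, e2]
      linear_combination (η f.1 * η g.1 * C₁ f e * C₁ g e) * hηη e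
    have hηR : ∀ f, (η f : LaurentPolynomial ℤ) * (η f : LaurentPolynomial ℤ) = 1 := by
      intro f
      rw [← Int.cast_mul, hηη, Int.cast_one]
    let φ : ({e : G₁.edgeSet // e ∉ T₁} → LaurentPolynomial ℤ) ≃ₗ[LaurentPolynomial ℤ]
        ({e : G₂.edgeSet // e ∉ T₂} → LaurentPolynomial ℤ) :=
      { toFun := fun x g => (η (π.symm g).1 : LaurentPolynomial ℤ) * x (π.symm g)
        invFun := fun y f => (η f.1 : LaurentPolynomial ℤ) * y (π f)
        map_add' := fun x y => by
          funext g
          simp only [Pi.add_apply, mul_add]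
        map_smul' := fun r x => by
          funext g
          simp only [Pi.smul_apply, smul_eq_mul, RingHom.id_apply]
          ring
        left_inv := fun x => by
          funext f
          simp only [Equiv.symm_apply_apply]
          rw [← mul_assoc, hηR, one_mul]
        right_inv := fun y => by
          funext g
          simp only [Equiv.apply_symm_apply]
          rw [← mul_assoc, hηR, one_mul] }
    have hφ : ∀ x f, φ x (π f) = (η f.1 : LaurentPolynomial ℤ) * x f := by
      intro x f
      change (η (π.symm (π f)).1 : LaurentPolynomial ℤ) * x (π.symm (π f)) = _
      rw [Equiv.symm_apply_apply]
    refine ⟨φ, fun x y => ?_, fun x => ?_⟩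
    · rw [← Equiv.sum_comp π]
      refine Finset.sum_congr rfl fun f _ => ?_
      rw [← Equiv.sum_comp π]
      refine Finset.sum_congr rfl fun g _ => ?_
      rw [hφ, hφ, gram_eq, gram_eq, hgram, map_mul, map_intCast]
      simp only [π.injective.eq_iff]
      by_cases hfg : f = g
      · subst hfg
        rw [hηη, one_mul]
        linear_combination (σ (x f) * (((if f = f then 1 else 0 : ℤ) : LaurentPolynomial ℤ) +
          (((∑ e, C₁ f e * C₁ f e) - (if f = f then 1 else 0) : ℤ) : LaurentPolynomial ℤ) *
          LaurentPolynomial.T 2) * y f) * hηR f.1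
      · simp only [if_neg hfg, Int.cast_mul, sub_zero, Int.cast_zero, zero_add]
        linear_combination (σ (x f) * ((∑ e, C₁ f e * C₁ g e : ℤ) : LaurentPolynomial ℤ) *
          LaurentPolynomial.T 2 * y g) * ((η g.1 : LaurentPolynomial ℤ) *
            (η g.1 : LaurentPolynomial ℤ) * hηR f.1 + hηR g.1)
    · funext g
      obtain ⟨f, rfl⟩ := π.surjective g
      rw [hφ, hφ, map_mul, map_intCast]
end

section
/- Let Γ be a finite connected oriented simple graph with spanning tree T, and set r := |T| = |V| − 1. Then det G_C(Γ,T) = ∑_{T'} q^{2·|T∖T'|}, where the sum ranges over all spanning trees T' of Γ. Equivalently, det G_C(Γ,T) = ∑_{i=0}^{r} cᵢ·q^{2i}, where cᵢ is the number of spanning trees T' of Γ with |T' ∩ T| = r − i (i.e. differing from T in exactly i edges); in particular c₀ = 1. -/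
open LaurentPolynomial

/-- The q-cut Gram matrix of `(Γ,T)` built from a family `K` of fundamental cuts. -/
noncomputable def qCutGram {V : Type} [DecidableEq V] (G : SimpleGraph V)
    [Fintype G.edgeSet] (T : Set G.edgeSet)
    (K : {e : G.edgeSet // e ∈ T} → G.edgeSet → ℤ) :
    Matrix {e : G.edgeSet // e ∈ T} {e : G.edgeSet // e ∈ T} (LaurentPolynomial ℤ) :=
  fun e e' => if e = e' then
    1 + (((∑ f, K e f * K e f) - 1 : ℤ) : LaurentPolynomial ℤ) * LaurentPolynomial.T 2
  else (((∑ f, K e f * K e' f : ℤ)) : LaurentPolynomial ℤ) * LaurentPolynomial.T 2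

/-- A form of the Cauchy–Binet formula. -/
theorem cauchyBinet {m n R : Type*} [Fintype m] [DecidableEq m] [Fintype n] [DecidableEq n]
    [CommRing R] (A : Matrix m n R) (B : Matrix n m R) (term : Finset n → R)
    (hterm : ∀ g : m → n, Function.Injective g →
      (A.submatrix id g).det * (B.submatrix g id).det = term (Finset.univ.image g)) :
    (A * B).det = ∑ S : Finset n, if S.card = Fintype.card m then term S else 0 := by
  have h1 : (A * B).det = ∑ p : m → n, (A.submatrix id p).det * ∏ i, B (p i) i := by
    simp only [Matrix.det_apply', Matrix.mul_apply, Finset.prod_univ_sum, Finset.mul_sum,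
      Fintype.piFinset_univ, Finset.sum_mul, Matrix.submatrix_apply, id]
    rw [Finset.sum_comm]
    refine Finset.sum_congr rfl fun p _ => Finset.sum_congr rfl fun σ _ => ?_
    rw [Finset.prod_mul_distrib, mul_assoc]
  rw [h1, ← Finset.sum_fiberwise Finset.univ (fun p : m → n => Finset.univ.image p)]
  refine Finset.sum_congr rfl fun S _ => ?_
  split_ifs with hS
  · have hcard : Fintype.card m = Fintype.card S := by simp [hS]
    let g : m ≃ S := Fintype.equivOfCardEq hcard
    have hginj : Function.Injective (fun i => (g i : n)) :=
      Subtype.val_injective.comp g.injective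
    have himg : Finset.univ.image (fun i => (g i : n)) = S := by
      ext x
      simp only [Finset.mem_image, Finset.mem_univ, true_and]
      constructor
      · rintro ⟨i, rfl⟩
        exact (g i).2
      · intro hx
        exact ⟨g.symm ⟨x, hx⟩, by simp⟩
    rw [← himg, ← hterm _ hginj, himg, Matrix.det_apply' (B.submatrix _ id), Finset.mul_sum]
    symm
    refine Finset.sum_bij (fun (τ : Equiv.Perm m) _ => fun i => (g (τ i) : n)) ?_ ?_ ?_ ?_
    · intro τ _
      simp only [Finset.mem_filter, Finset.mem_univ, true_and]
      refine Eq.trans ?_ himg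
      ext x
      simp only [Finset.mem_image, Finset.mem_univ, true_and]
      constructor
      · rintro ⟨i, rfl⟩
        exact ⟨τ i, rfl⟩
      · rintro ⟨i, rfl⟩
        exact ⟨τ.symm i, by simp⟩
    · intro τ _ τ' _ h
      ext i
      exact hginj (congrFun h i)
    · intro p hp
      simp only [Finset.mem_filter, Finset.mem_univ, true_and] at hp
      have hpS : ∀ i, p i ∈ S := fun i => by
        rw [← hp]; exact Finset.mem_image_of_mem _ (Finset.mem_univ _)
      have hpinj : Function.Injective p := by
        have hc : (Finset.univ.image p).card = (Finset.univ : Finset m).card := by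
          rw [hp, hS]
          rfl
        have := Finset.card_image_iff.mp hc
        simpa using this
      have hf : Function.Injective (fun i => g.symm ⟨p i, hpS i⟩) := by
        intro i j hij
        apply hpinj
        have := g.symm.injective hij
        simpa using this
      refine ⟨Equiv.ofBijective _ (Finite.injective_iff_bijective.mp hf), Finset.mem_univ _, ?_⟩
      funext i
      simp
    · intro τ _
      have : A.submatrix id (fun i => (g (τ i) : n)) =
          (A.submatrix id (fun i => (g i : n))).submatrix id τ := rfl
      rw [this, Matrix.det_permute']
      simp only [Matrix.submatrix_apply, id]
      ring
  · refine Finset.sum_eq_zero fun p hp => ?_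
    simp only [Finset.mem_filter, Finset.mem_univ, true_and] at hp
    have hpinj : ¬ Function.Injective p := by
      intro hinj
      apply hS
      rw [← hp, Finset.card_image_of_injective _ hinj]
      rfl
    simp only [Function.Injective, not_forall] at hpinj
    obtain ⟨i, j, hij, hne⟩ := hpinj
    rw [Matrix.det_zero_of_column_eq hne (fun k => by simp [hij]), zero_mul]

section graph

variable {V : Type} [Fintype V] [DecidableEq V] {G : SimpleGraph V}
  {head tail : G.edgeSet → V}

theorem head_ne_tail (hor : IsOrientation G head tail) (e : G.edgeSet) : head e ≠ tail e := by
  intro h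
  have h2 := e.2
  rw [hor e, SimpleGraph.mem_edgeSet] at h2
  exact h2.ne h

theorem incMat_tr_mulVec (hor : IsOrientation G head tail) (y : V → ℤ) (e : G.edgeSet) :
    (incMat G head tail).transpose.mulVec y e = y (head e) - y (tail e) := by
  have hne := head_ne_tail hor e
  have : ∀ v, (if v = head e then (1 : ℤ) else if v = tail e then -1 else 0) * y v =
      (if v = head e then y v else 0) - (if v = tail e then y v else 0) := by
    intro v
    by_cases h1 : v = head e
    · subst h1; simp [hne]
    · by_cases h2 : v = tail e <;> simp [h1, h2, hne.symm]
  simp only [Matrix.mulVec, dotProduct, Matrix.transpose_apply, incMat, this,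
    Finset.sum_sub_distrib]
  simp

/-- A potential without drop along the edges of a connected spanning subgraph is constant. -/
theorem potential_const {α : Type*} (hor : IsOrientation G head tail) (S : Set G.edgeSet)
    (hS : (SimpleGraph.fromEdgeSet (Subtype.val '' S)).Connected) (y : V → α)
    (hy : ∀ e ∈ S, y (head e) = y (tail e)) (u v : V) : y u = y v := by
  obtain ⟨w⟩ := hS.preconnected u v
  induction w with
  | nil => rfl
  | cons h w ih =>
    rw [← ih]
    rw [SimpleGraph.fromEdgeSet_adj] at h
    obtain ⟨⟨e, heS, he⟩, _⟩ := h
    have h1 := hy e heS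
    rw [hor e, Sym2.eq_iff] at he
    rcases he with ⟨h2, h3⟩ | ⟨h2, h3⟩
    · rw [← h2, ← h3, h1]
    · rw [← h2, ← h3, h1]

/-- If the spanning subgraph is not connected, there is a potential witnessing it. -/
theorem exists_potential_s14 (hor : IsOrientation G head tail) (hconn : G.Connected)
    (S : Set G.edgeSet)
    (hS : ¬ (SimpleGraph.fromEdgeSet (Subtype.val '' S)).Connected) :
    ∃ y : V → ℤ, (∀ e ∈ S, y (head e) = y (tail e)) ∧ ∃ u v, y u ≠ y v := by
  classical
  have hne := hconn.nonempty
  have : ¬ (SimpleGraph.fromEdgeSet (Subtype.val '' S)).Preconnected := fun h => hS ⟨h⟩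
  simp only [SimpleGraph.Preconnected, not_forall] at this
  obtain ⟨u, v, huv⟩ := this
  refine ⟨fun x => if (SimpleGraph.fromEdgeSet (Subtype.val '' S)).Reachable u x then 1 else 0,
    ?_, u, v, by simp [huv]⟩
  intro e he
  have hadj : (SimpleGraph.fromEdgeSet (Subtype.val '' S)).Adj (head e) (tail e) := by
    rw [SimpleGraph.fromEdgeSet_adj]
    exact ⟨⟨e, he, hor e⟩, head_ne_tail hor e⟩
  have : (SimpleGraph.fromEdgeSet (Subtype.val '' S)).Reachable u (head e) ↔
      (SimpleGraph.fromEdgeSet (Subtype.val '' S)).Reachable u (tail e) :=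
    ⟨fun h => h.trans hadj.reachable, fun h => h.trans hadj.symm.reachable⟩
  simp [this]

variable (hor : IsOrientation G head tail) {T : Set G.edgeSet}
    {K : {e : G.edgeSet // e ∈ T} → G.edgeSet → ℤ}

theorem cut_det_zero [Fintype {e : G.edgeSet // e ∈ T}] [DecidableEq {e : G.edgeSet // e ∈ T}]
    (hor : IsOrientation G head tail) (hconn : G.Connected) (hT : IsSpanningTree G T)
    (hKrow : ∀ e, ∃ y : V → ℤ, (incMat G head tail).transpose.mulVec y = K e)
    (hKe : ∀ e, K e e.val = 1)
    (hKsupp : ∀ e (e' : G.edgeSet), e' ∈ T → e' ≠ e.val → K e e' = 0)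
    (g : {e : G.edgeSet // e ∈ T} → G.edgeSet)
    (hS : ¬ (SimpleGraph.fromEdgeSet (Subtype.val '' (Set.range g))).Connected) :
    (Matrix.of fun i j => K i (g j)).det = 0 := by
  obtain ⟨y, hy, u, v, huv⟩ := exists_potential_s14 hor hconn _ hS
  rw [← Matrix.exists_vecMul_eq_zero_iff]
  choose Y hY using hKrow
  have hY' : ∀ i f, K i f = Y i (head f) - Y i (tail f) := fun i f => by
    rw [← hY, incMat_tr_mulVec hor]
  let x : {e : G.edgeSet // e ∈ T} → ℤ := fun i => y (head i) - y (tail i)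
  have hxT : ∀ j : {e : G.edgeSet // e ∈ T}, ∑ i, x i * K i j = x j := by
    intro j
    rw [Finset.sum_eq_single j]
    · rw [hKe, mul_one]
    · intro i _ hij
      rw [hKsupp i j j.2 (fun h => hij (Subtype.ext h.symm)), mul_zero]
    · simp
  have hdrop : ∀ f, ∑ i, x i * K i f =
      (∑ i, x i * Y i (head f)) - ∑ i, x i * Y i (tail f) := by
    intro f
    simp only [hY', mul_sub, Finset.sum_sub_distrib]
  have hconst := potential_const hor T hT.1 (fun w => y w - ∑ i, x i * Y i w) (by
    intro e he
    have h1 := hxT ⟨e, he⟩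
    rw [hdrop] at h1
    simp only [x] at h1 ⊢
    linarith)
  refine ⟨x, ?_, ?_⟩
  · intro hx0
    apply huv
    have := hconst u v
    simpa [hx0] using this
  · funext j
    simp only [Matrix.vecMul, dotProduct, Matrix.of_apply, Pi.zero_apply]
    rw [hdrop]
    have h1 := hconst (head (g j)) (tail (g j))
    have h2 := hy (g j) ⟨j, rfl⟩
    linarith

theorem cut_det_unit [Fintype {e : G.edgeSet // e ∈ T}] [DecidableEq {e : G.edgeSet // e ∈ T}]
    (hor : IsOrientation G head tail)
    (hKrow : ∀ e, ∃ y : V → ℤ, (incMat G head tail).transpose.mulVec y = K e)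
    (hKe : ∀ e, K e e.val = 1)
    (hKsupp : ∀ e (e' : G.edgeSet), e' ∈ T → e' ≠ e.val → K e e' = 0)
    (g : {e : G.edgeSet // e ∈ T} → G.edgeSet)
    (hS : (SimpleGraph.fromEdgeSet (Subtype.val '' (Set.range g))).Connected) :
    (Matrix.of fun i j => K i (g j)).det * (Matrix.of fun i j => K i (g j)).det = 1 := by
  choose Y hY using hKrow
  have hY' : ∀ i f, K i f = Y i (head f) - Y i (tail f) := fun i f => by
    rw [← hY, incMat_tr_mulVec hor]
  suffices h : (Matrix.of fun i j => K i (g j)).det.natAbs = 1 by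
    rcases Int.natAbs_eq_iff.mp h with h | h <;> rw [h] <;> norm_num
  by_contra hne
  obtain ⟨p, hp, hdvd⟩ := Nat.exists_prime_and_dvd hne
  have := Fact.mk hp
  have h0 : ((Matrix.of fun i j => K i (g j)).det : ZMod p) = 0 := by
    rw [ZMod.intCast_zmod_eq_zero_iff_dvd]
    exact Int.natCast_dvd.mpr hdvd
  have h0' : (Matrix.of fun i j => (K i (g j) : ZMod p)).det = 0 := by
    rw [← h0]
    have := (RingHom.map_det (Int.castRingHom (ZMod p)) (Matrix.of fun i j => K i (g j)))
    simp only [eq_intCast] at this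
    rw [this]
    congr 1
  rw [← Matrix.exists_vecMul_eq_zero_iff] at h0'
  obtain ⟨x, hx, hx0⟩ := h0'
  have hdrop : ∀ f, ∑ i, x i * (K i f : ZMod p) =
      (∑ i, x i * (Y i (head f) : ZMod p)) - ∑ i, x i * (Y i (tail f) : ZMod p) := by
    intro f
    simp only [hY', Int.cast_sub, mul_sub, Finset.sum_sub_distrib]
  have hconst := potential_const hor _ hS (fun w => ∑ i, x i * (Y i w : ZMod p)) (by
    rintro e ⟨j, rfl⟩
    have h1 := congrFun hx0 j
    simp only [Matrix.vecMul, dotProduct, Matrix.of_apply, Pi.zero_apply] at h1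
    rw [hdrop] at h1
    exact sub_eq_zero.mp h1)
  apply hx
  funext j
  have hxT : ∑ i, x i * (K i j : ZMod p) = x j := by
    rw [Finset.sum_eq_single j]
    · rw [hKe, Int.cast_one, mul_one]
    · intro i _ hij
      rw [hKsupp i j j.2 (fun h => hij (Subtype.ext h.symm)), Int.cast_zero, mul_zero]
    · simp
  rw [← hxT, hdrop, sub_eq_zero.mpr (hconst _ _)]
  rfl

end graph

theorem qCutGram_eq {V : Type} [DecidableEq V] (G : SimpleGraph V)
    [Fintype G.edgeSet] (T : Set G.edgeSet) [DecidablePred (· ∈ T)]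
    (K : {e : G.edgeSet // e ∈ T} → G.edgeSet → ℤ)
    (hKe : ∀ e, K e e.val = 1)
    (hKsupp : ∀ e (e' : G.edgeSet), e' ∈ T → e' ≠ e.val → K e e' = 0) :
    qCutGram G T K = (Matrix.of fun i f => (K i f : LaurentPolynomial ℤ)) *
      (Matrix.of fun f i => (if f ∈ T then 1 else LaurentPolynomial.T 2) *
        (K i f : LaurentPolynomial ℤ)) := by
  classical
  ext1 i j
  simp only [Matrix.mul_apply, Matrix.of_apply, qCutGram]
  have key : ∑ f, (K i f : LaurentPolynomial ℤ) *
      ((if f ∈ T then 1 else LaurentPolynomial.T 2) * (K j f : LaurentPolynomial ℤ)) =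
      ((∑ f, K i f * K j f : ℤ) : LaurentPolynomial ℤ) * LaurentPolynomial.T 2 +
      (if i = j then 1 - LaurentPolynomial.T 2 else 0) := by
    have h2 : ∀ f, (K i f : LaurentPolynomial ℤ) *
      ((if f ∈ T then 1 else LaurentPolynomial.T 2) * (K j f : LaurentPolynomial ℤ)) =
      (K i f : LaurentPolynomial ℤ) * (K j f : LaurentPolynomial ℤ) * LaurentPolynomial.T 2 +
      (if f = i.val then (if i = j then 1 - LaurentPolynomial.T 2 else 0) else 0) := by
      intro f
      by_cases hf : f ∈ T
      · by_cases hfi : f = i.val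
        · subst hfi
          by_cases hij : i = j
          · subst hij
            simp [hKe]
          · have := hKsupp j i hf (fun h => hij (Subtype.ext h))
            simp [this, hij]
        · have := hKsupp i f hf hfi
          simp [this, hfi]
      · have : f ≠ i.val := fun h => hf (h ▸ i.2)
        simp only [hf, this, if_false]
        ring
    rw [Finset.sum_congr rfl (fun f _ => h2 f), Finset.sum_add_distrib, ← Finset.sum_mul]
    simp
  rw [key]
  by_cases hij : i = j
  · subst hij
    simp only [if_true]
    push_cast
    ring
  · simp [hij]

open scoped Classical in
/-- q-Matrix-Tree theorem.  For a finite connected oriented simple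
graph `Γ` with spanning tree `T` and fundamental cuts `K`, the determinant of the q-cut
Gram matrix is `∑_{T'} q^{2·|T∖T'|}`, the sum over all spanning trees `T'` of `Γ`. -/
theorem stmt14 (V : Type) [Fintype V] [DecidableEq V] (G : SimpleGraph V)
    [Fintype G.edgeSet]
    (head tail : G.edgeSet → V) (hor : IsOrientation G head tail)
    (hconn : G.Connected)
    (T : Set G.edgeSet) (hT : IsSpanningTree G T)
    (K : {e : G.edgeSet // e ∈ T} → G.edgeSet → ℤ)
    (hKrow : ∀ e, ∃ y : V → ℤ, (incMat G head tail).transpose.mulVec y = K e)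
    (hKe : ∀ e, K e e.val = 1)
    (hKsupp : ∀ e (e' : G.edgeSet), e' ∈ T → e' ≠ e.val → K e e' = 0) :
    (qCutGram G T K).det =
      ∑ T' : {S : Set G.edgeSet // IsSpanningTree G S},
        LaurentPolynomial.T (2 * ((T \ T'.val).ncard : ℤ)) := by
  have hTcard : T.ncard = Fintype.card {e : G.edgeSet // e ∈ T} := by
    rw [← Nat.card_coe_set_eq, ← Nat.card_eq_fintype_card]
  have hdet : (qCutGram G T K).det = ∑ S : Finset G.edgeSet,
      if S.card = Fintype.card {e : G.edgeSet // e ∈ T} then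
        (if IsSpanningTree G (S : Set G.edgeSet) then
          LaurentPolynomial.T (2 * ((T \ (S : Set G.edgeSet)).ncard : ℤ)) else
          (0 : LaurentPolynomial ℤ)) else 0 := by
    rw [qCutGram_eq G T K hKe hKsupp]
    refine cauchyBinet _ _ (fun (S : Finset G.edgeSet) => if IsSpanningTree G (S : Set G.edgeSet) then
          LaurentPolynomial.T (2 * ((T \ (S : Set G.edgeSet)).ncard : ℤ)) else
          (0 : LaurentPolynomial ℤ)) ?_
    intro g hg
    have hrange : ((Finset.univ.image g : Finset G.edgeSet) : Set G.edgeSet) = Set.range g := by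
      simp
    have hcard : (Set.range g).ncard = T.ncard := by
      rw [← Set.image_univ, Set.ncard_image_of_injective _ hg, Set.ncard_univ,
        Nat.card_eq_fintype_card, hTcard]
    have hA : ((Matrix.of fun i f => (K i f : LaurentPolynomial ℤ)).submatrix id g).det =
        (((Matrix.of fun i j => K i (g j)).det : ℤ) : LaurentPolynomial ℤ) := by
      have := (RingHom.map_det (Int.castRingHom (LaurentPolynomial ℤ))
        (Matrix.of fun i j => K i (g j)))
      simp only [eq_intCast] at this
      rw [this]
      congr 1
    have hB : ((Matrix.of fun f i => (if f ∈ T then 1 else LaurentPolynomial.T 2) *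
        (K i f : LaurentPolynomial ℤ)).submatrix g id).det =
        (∏ i, (if g i ∈ T then 1 else LaurentPolynomial.T 2)) *
        (((Matrix.of fun i j => K i (g j)).det : ℤ) : LaurentPolynomial ℤ) := by
      rw [← hA, ← Matrix.det_transpose (Matrix.submatrix _ id g), ← Matrix.det_mul_column]
      rfl
    rw [hA, hB, hrange]
    split_ifs with hst
    · have hu := cut_det_unit hor hKrow hKe hKsupp g hst.1
      have hu' : (((Matrix.of fun i j => K i (g j)).det : ℤ) : LaurentPolynomial ℤ) *
        (((Matrix.of fun i j => K i (g j)).det : ℤ) : LaurentPolynomial ℤ) = 1 := by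
        rw [← Int.cast_mul, hu, Int.cast_one]
      rw [mul_left_comm, hu', mul_one, Finset.prod_ite, Finset.prod_const_one, one_mul,
        Finset.prod_const, LaurentPolynomial.T_pow]
      have h3 : (T \ Set.range g).ncard = (Set.range g \ T).ncard :=
        (Set.ncard_eq_ncard_iff_ncard_diff_eq_ncard_diff (Set.toFinite _) (Set.toFinite _)).mp
          hcard.symm
      have h4 : Set.range g \ T = g '' {i | g i ∉ T} := by
        ext x
        constructor
        · rintro ⟨⟨i, rfl⟩, h⟩
          exact ⟨i, h, rfl⟩
        · rintro ⟨i, h, rfl⟩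
          exact ⟨⟨i, rfl⟩, h⟩
      have h5 : (Finset.univ.filter fun i => g i ∉ T).card = (Set.range g \ T).ncard := by
        rw [h4, Set.ncard_image_of_injective _ hg, ← Set.ncard_coe_finset]
        congr 1
        ext; simp
      rw [h3, h5, mul_comm]
    · rw [cut_det_zero hor hconn hT hKrow hKe hKsupp g
        (fun h => hst ⟨h, by rw [hcard]; exact hT.2⟩)]
      simp
  rw [hdet]
  simp only [← ite_and]
  rw [← Finset.sum_filter]
  refine Finset.sum_bij' (fun (S : Finset G.edgeSet) hS => ⟨(S : Set G.edgeSet), (Finset.mem_filter.mp hS).2.2⟩)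
    (fun T' _ => T'.val.toFinset) ?_ ?_ ?_ ?_ ?_
  · intros; exact Finset.mem_univ _
  · rintro ⟨S, hS⟩ _
    simp only [Finset.mem_filter, Finset.mem_univ, true_and, Set.coe_toFinset]
    refine ⟨?_, hS⟩
    rw [← Set.ncard_eq_toFinset_card', ← hTcard]
    have h1 := hS.2
    have h2 := hT.2
    omega
  · intros; simp
  · intros; simp
  · intros; rfl
end
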